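/- Let (X_η, S) be a B-free subshift such that B is taut and (X_η, S) is proximal. Then the automorphism group of (X_η, S) is trivial: every bijective cellular automaton τ on (X_η, S) equals S^n for some n ∈ ℤ. -/

import Mathlib

open Filter Set

noncomputable section

/-- The shift by `t`: `(shiftPow t x) n = x (n + t)`, i.e. `S^t`. -/
def shiftPow (t : ℤ) (x : ℤ → Bool) : ℤ → Bool := fun n => x (n + t)

/-- The left shift `S`, `(S x) n = x (n + 1)`. -/
def shift : (ℤ → Bool) → (ℤ → Bool) := shiftPow 1

/-- The support of a `0-1`-sequence. -/
def supp (x : ℤ → Bool) : Set ℤ := {n | x n = true}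

/-- The all-zero sequence `0^ℤ`. -/
def zeroSeq : ℤ → Bool := fun _ => false

/-- The all-one sequence `1^ℤ`. -/
def oneSeq : ℤ → Bool := fun _ => true

/-- The sequence `u = 0^{-ℕ} 1 0^{ℕ}` with a single `1` at position `0`. -/
def uSeq : ℤ → Bool := fun n => if n = 0 then true else false

/-- The set `F_B ⊆ ℤ` of `B`-free integers. -/
def BFreeSet (B : Set ℕ) : Set ℤ := {n | ∀ b ∈ B, ¬ ((b : ℤ) ∣ n)}

open Classical in
/-- `η`, the indicator function of the `B`-free integers. -/
noncomputable def eta (B : Set ℕ) : ℤ → Bool := fun n => if n ∈ BFreeSet B then true else false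

/-- The `B`-free subshift `X_η`: the orbit closure of `η` under the shift. -/
def Xeta (B : Set ℕ) : Set (ℤ → Bool) := closure {x | ∃ t : ℤ, x = shiftPow t (eta B)}

/-- A set `A ⊆ ℤ` is `B`-admissible if for every `b ∈ B` some residue class
mod `b` is disjoint from `A`. -/
def IsBAdmissible (B : Set ℕ) (A : Set ℤ) : Prop :=
  ∀ b ∈ B, ∃ r : ℤ, ∀ a ∈ A, ¬ ((b : ℤ) ∣ (a - r))

/-- The `B`-admissible subshift `X_B`. -/
def XB (B : Set ℕ) : Set (ℤ → Bool) := {x | IsBAdmissible B (supp x)}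

/-- `B` is primitive: no element divides a different element. -/
def Primitive (B : Set ℕ) : Prop := ∀ a ∈ B, ∀ b ∈ B, a ∣ b → a = b

/-- `B` is an Erdős set: infinite, `1 ∉ B` (elements positive), primitive, pairwise
coprime and thin. -/
def IsErdos (B : Set ℕ) : Prop :=
  B.Infinite ∧ (∀ b ∈ B, 2 ≤ b) ∧ Primitive B ∧
    (∀ a ∈ B, ∀ b ∈ B, a ≠ b → Nat.Coprime a b) ∧
    Summable (fun b : B => (1 : ℝ) / (b : ℝ))

/-- A cellular automaton on `X`: a continuous self-map of `X` commuting with the shift. -/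
def IsCA (X : Set (ℤ → Bool)) (τ : (ℤ → Bool) → (ℤ → Bool)) : Prop :=
  Set.MapsTo τ X X ∧ ContinuousOn τ X ∧ ∀ x ∈ X, τ (shift x) = shift (τ x)

/-- Pre-injectivity of a CA on `X`. -/
def PreInjective (X : Set (ℤ → Bool)) (τ : (ℤ → Bool) → (ℤ → Bool)) : Prop :=
  ∀ x ∈ X, ∀ y ∈ X, τ x = τ y → {n : ℤ | x n ≠ y n}.Finite → x = y

/-- `X` is hereditary. -/
def Hereditary (X : Set (ℤ → Bool)) : Prop :=
  ∀ x ∈ X, ∀ y : ℤ → Bool, (∀ n, y n ≤ x n) → y ∈ X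

/-- The hereditary closure `X̃` of a set `X`. -/
def heredClosure (X : Set (ℤ → Bool)) : Set (ℤ → Bool) :=
  {y | ∃ x ∈ X, ∀ n, y n ≤ x n}

/-- `X` is a subshift: nonempty, closed and shift-invariant. -/
def IsSubshift (X : Set (ℤ → Bool)) : Prop :=
  X.Nonempty ∧ IsClosed X ∧ shift '' X = X

/-- `τ` is given by a (sliding block) code of radius `ℓ` on `X`. -/
def HasRadius (X : Set (ℤ → Bool)) (τ : (ℤ → Bool) → (ℤ → Bool)) (ℓ : ℕ) : Prop :=
  ∀ x ∈ X, ∀ y ∈ X, ∀ n : ℤ,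
    (∀ i : ℤ, n - ℓ ≤ i → i ≤ n + ℓ → x i = y i) → τ x n = τ y n

open Classical in
/-- `A ⊆ ℤ` has logarithmic density `d`. -/
noncomputable def HasLogDensity (A : Set ℤ) (d : ℝ) : Prop :=
  Tendsto (fun N : ℕ =>
      (Real.log N)⁻¹ * ∑ n ∈ Finset.Icc 1 N, (if (n : ℤ) ∈ A then (1 : ℝ) / (n : ℝ) else 0))
    atTop (nhds d)

/-- `B` is taut: removing any `b ∈ B` strictly increases the logarithmic density of the
`B`-free integers. -/
def IsTaut (B : Set ℕ) : Prop :=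
  ∀ b ∈ B, ∀ d d' : ℝ,
    HasLogDensity (BFreeSet B) d → HasLogDensity (BFreeSet (B \ {b})) d' → d < d'

/-- `x` and `y` are proximal: along some sequence `r k → ∞`, the shifted sequences
`S^{r k} x` and `S^{r k} y` agree on arbitrarily large central windows, i.e.
`d(S^{r k} x, S^{r k} y) → 0` in the product topology. -/
def ProximalPair (x y : ℤ → Bool) : Prop :=
  ∃ r : ℕ → ℤ, Tendsto r atTop atTop ∧
    ∀ m : ℕ, ∀ᶠ k in atTop, ∀ n : ℤ, |n| ≤ (m : ℤ) →
      shiftPow (r k) x n = shiftPow (r k) y n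

/-- A subshift is proximal if every pair of its points is proximal. -/
def IsProximalSubshift (X : Set (ℤ → Bool)) : Prop :=
  ∀ x ∈ X, ∀ y ∈ X, ProximalPair x y

end

/-- The mass of `E ⊆ ℕ` under the weights `n ↦ n ^ (-s)` (the weight of `0` is `0`). -/
noncomputable def zetaMass (s : ℝ) (E : Set ℕ) : ℝ :=
  ∑' n : ℕ, E.indicator (fun n : ℕ => (n : ℝ) ^ (-s)) n

/-- The zeta distribution with parameter `s`. -/
noncomputable def zetaProb (s : ℝ) (E : Set ℕ) : ℝ := zetaMass s E / zetaMass s univ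

theorem summable_zetaMass {s : ℝ} (hs : 1 < s) (E : Set ℕ) :
    Summable (E.indicator (fun n : ℕ => (n : ℝ) ^ (-s))) :=
  (Real.summable_nat_rpow.2 (by linarith)).indicator E

theorem zetaWeight_nonneg (s : ℝ) (E : Set ℕ) (n : ℕ) :
    0 ≤ E.indicator (fun n : ℕ => (n : ℝ) ^ (-s)) n :=
  indicator_nonneg (fun _ _ => by positivity) n

theorem zetaMass_nonneg (s : ℝ) (E : Set ℕ) : 0 ≤ zetaMass s E :=
  tsum_nonneg (zetaWeight_nonneg s E)

theorem zetaMass_mono {s : ℝ} (hs : 1 < s) {E F : Set ℕ} (h : E ⊆ F) :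
    zetaMass s E ≤ zetaMass s F :=
  Summable.tsum_le_tsum (fun n => indicator_le_indicator_of_subset h (fun _ => by positivity) n)
    (summable_zetaMass hs E) (summable_zetaMass hs F)

theorem one_le_zetaMass_univ {s : ℝ} (hs : 1 < s) : 1 ≤ zetaMass s univ := by
  have := (summable_zetaMass hs univ).le_tsum 1 (fun n _ => zetaWeight_nonneg s univ n)
  simpa [zetaMass] using this

theorem zetaMass_union {s : ℝ} (hs : 1 < s) {E F : Set ℕ} (h : Disjoint E F) :
    zetaMass s (E ∪ F) = zetaMass s E + zetaMass s F := by
  unfold zetaMass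
  rw [← (summable_zetaMass hs E).tsum_add (summable_zetaMass hs F)]
  congr 1
  ext n
  rw [indicator_union_of_disjoint h]

theorem zetaMass_dilate (s : ℝ) {c : ℕ} (hc : 0 < c) (E : Set ℕ) :
    zetaMass s {n | c ∣ n ∧ n ∈ E} = (c : ℝ) ^ (-s) * zetaMass s {k | c * k ∈ E} := by
  have hinj : Function.Injective (fun k : ℕ => c * k) := fun a b h => by
    simpa [hc.ne'] using h
  unfold zetaMass
  rw [← hinj.tsum_eq, ← tsum_mul_left]
  · congr 1
    ext k
    by_cases hk : c * k ∈ E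
    · rw [indicator_of_mem (by simpa using hk), indicator_of_mem (by simpa using hk)]
      push_cast
      rw [Real.mul_rpow (by positivity) (by positivity)]
    · rw [indicator_of_notMem (by simpa using hk), indicator_of_notMem (by simpa using hk), mul_zero]
  · intro n hn
    have : n ∈ {n | c ∣ n ∧ n ∈ E} := by
      by_contra h
      exact hn (indicator_of_notMem h _)
    obtain ⟨⟨k, rfl⟩, -⟩ := this
    exact ⟨k, rfl⟩

theorem tendsto_sub_one_mul_zetaMass_univ :
    Tendsto (fun s : ℝ => (s - 1) * zetaMass s univ) (nhdsWithin 1 (Ioi 1)) (nhds 1) := by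
  refine tendsto_sub_mul_tsum_nat_rpow.congr fun s => ?_
  simp [zetaMass, Real.rpow_neg]

theorem tendsto_inv_zetaMass_univ :
    Tendsto (fun s : ℝ => (zetaMass s univ)⁻¹) (nhdsWithin 1 (Ioi 1)) (nhds 0) := by
  have h1 : Tendsto (fun s : ℝ => s - 1) (nhdsWithin 1 (Ioi 1)) (nhds 0) := by
    have : Tendsto (fun s : ℝ => s - 1) (nhds 1) (nhds (1 - 1)) :=
      (continuous_id.sub continuous_const).tendsto 1
    simpa using this.mono_left nhdsWithin_le_nhds
  have h2 := h1.mul (tendsto_sub_one_mul_zetaMass_univ.inv₀ one_ne_zero)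
  rw [zero_mul] at h2
  refine h2.congr' ?_
  filter_upwards [self_mem_nhdsWithin] with s (hs : 1 < s)
  have : s - 1 ≠ 0 := by linarith
  rw [mul_inv, ← mul_assoc, mul_inv_cancel₀ this, one_mul]

theorem abs_zetaMass_succ_sub_le {s : ℝ} (hs : 1 < s) (E : Set ℕ) :
    |zetaMass s {m | m + 1 ∈ E} - zetaMass s E| ≤ 1 := by
  set w : ℕ → ℝ := fun n => (n : ℝ) ^ (-s) with hw
  have hw0 : w 0 = 0 := by simp [hw, Real.zero_rpow (show -s ≠ 0 by linarith)]
  have hw1 : w 1 = 1 := by simp [hw]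
  have hanti : ∀ n, w (n + 2) ≤ w (n + 1) := fun n => by
    simp only [hw]
    apply Real.rpow_le_rpow_of_nonpos (by positivity) (by push_cast; linarith) (by linarith)
  have hwnn : ∀ n, 0 ≤ w n := fun n => by positivity
  classical
  set χ : ℕ → ℝ := fun n => if n ∈ E then 1 else 0 with hχ
  have hχ0 : ∀ n, 0 ≤ χ n := fun n => by simp only [hχ]; split_ifs <;> norm_num
  have hχ1 : ∀ n, χ n ≤ 1 := fun n => by simp only [hχ]; split_ifs <;> norm_num
  have e1 : zetaMass s {m | m + 1 ∈ E} = ∑' m, χ (m + 2) * w (m + 1) := by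
    have := (summable_zetaMass hs {m | m + 1 ∈ E}).tsum_eq_zero_add
    rw [zetaMass, this]
    have h0 : ({m | m + 1 ∈ E} : Set ℕ).indicator w 0 = 0 := by
      simp [indicator, hw0]
    rw [h0, zero_add]
    congr 1; ext m; simp [indicator, hχ, hw]
  have s2 : Summable (fun m => χ (m + 2) * w (m + 2)) := by
    have := (summable_nat_add_iff 2).2 (summable_zetaMass hs E)
    refine this.congr fun m => ?_
    simp [indicator, hχ, hw]
  have s1 : Summable (fun m => χ (m + 2) * w (m + 1)) := by
    have := (summable_nat_add_iff 1).2 (summable_zetaMass hs {m | m + 1 ∈ E})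
    refine this.congr fun m => ?_
    simp [indicator, hχ, hw]
  have e2 : zetaMass s E = χ 1 + ∑' m, χ (m + 2) * w (m + 2) := by
    rw [zetaMass, (summable_zetaMass hs E).tsum_eq_zero_add,
      ((summable_nat_add_iff 1).2 (summable_zetaMass hs E)).tsum_eq_zero_add]
    have h0 : E.indicator w 0 = 0 := by simp [indicator, hw0]
    have h1 : E.indicator w 1 = χ 1 := by simp [indicator, hχ, hw1]
    rw [h0, zero_add]
    congr 1
    congr 1; ext m; simp [indicator, hχ, hw, add_assoc, one_add_one_eq_two]
  have e3 : zetaMass s {m | m + 1 ∈ E} - zetaMass s E =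
      -χ 1 + ∑' m, χ (m + 2) * (w (m + 1) - w (m + 2)) := by
    rw [e1, e2]
    have : ∑' m, χ (m + 2) * (w (m + 1) - w (m + 2)) =
        ∑' m, χ (m + 2) * w (m + 1) - ∑' m, χ (m + 2) * w (m + 2) := by
      rw [← s1.tsum_sub s2]; congr 1; ext m; ring
    rw [this]; ring
  have nn : ∀ m, 0 ≤ χ (m + 2) * (w (m + 1) - w (m + 2)) := fun m =>
    mul_nonneg (hχ0 _) (sub_nonneg.2 (hanti m))
  have up : ∑' m, χ (m + 2) * (w (m + 1) - w (m + 2)) ≤ 1 := by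
    refine Real.tsum_le_of_sum_range_le nn fun n => ?_
    calc ∑ i ∈ Finset.range n, χ (i + 2) * (w (i + 1) - w (i + 2))
        ≤ ∑ i ∈ Finset.range n, (w (i + 1) - w (i + 1 + 1)) := by
          refine Finset.sum_le_sum fun i _ => ?_
          exact mul_le_of_le_one_left (sub_nonneg.2 (hanti i)) (hχ1 _)
      _ = w 1 - w (n + 1) := Finset.sum_range_sub' (fun i => w (i + 1)) n
      _ ≤ 1 := by rw [hw1]; linarith [hwnn (n + 1)]
  have lo : 0 ≤ ∑' m, χ (m + 2) * (w (m + 1) - w (m + 2)) := tsum_nonneg nn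
  rw [e3, abs_le]
  constructor <;> linarith [hχ0 1, hχ1 1]

theorem abs_zetaMass_shift_sub_le {s : ℝ} (hs : 1 < s) (a : ℕ) (E : Set ℕ) :
    |zetaMass s {m | m + a ∈ E} - zetaMass s E| ≤ a := by
  induction a with
  | zero => simp
  | succ a ih =>
    have h := abs_zetaMass_succ_sub_le hs {m | m + a ∈ E}
    have e : {m | m + 1 ∈ {m | m + a ∈ E}} = {m | m + (a + 1) ∈ E} := by
      ext m; simp only [mem_ofPred_eq]; rw [add_right_comm, add_assoc]
    rw [e] at h
    push_cast
    rw [abs_le] at *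
    constructor <;> linarith [h.1, h.2, ih.1, ih.2]

section zetaProb

theorem zetaProb_nonneg (s : ℝ) (E : Set ℕ) : 0 ≤ zetaProb s E :=
  div_nonneg (zetaMass_nonneg _ _) (zetaMass_nonneg _ _)

theorem zetaProb_mono {s : ℝ} (hs : 1 < s) {E F : Set ℕ} (h : E ⊆ F) :
    zetaProb s E ≤ zetaProb s F :=
  div_le_div_of_nonneg_right (zetaMass_mono hs h) (zetaMass_nonneg _ _)

theorem zetaProb_univ {s : ℝ} (hs : 1 < s) : zetaProb s univ = 1 :=
  div_self (by linarith [one_le_zetaMass_univ hs])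

theorem zetaProb_le_one {s : ℝ} (hs : 1 < s) (E : Set ℕ) : zetaProb s E ≤ 1 :=
  zetaProb_univ hs ▸ zetaProb_mono hs (subset_univ E)

theorem zetaProb_inter_add_diff {s : ℝ} (hs : 1 < s) (E F : Set ℕ) :
    zetaProb s (E ∩ F) + zetaProb s (E \ F) = zetaProb s E := by
  rw [zetaProb, zetaProb, zetaProb, ← add_div, ← zetaMass_union hs, inter_union_sdiff]
  exact disjoint_sdiff_inter.symm

theorem zetaProb_compl {s : ℝ} (hs : 1 < s) (E : Set ℕ) :
    zetaProb s Eᶜ = 1 - zetaProb s E := by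
  have := zetaProb_inter_add_diff hs univ E
  rw [univ_inter, ← compl_eq_univ_sdiff, zetaProb_univ hs] at this
  linarith

theorem zetaProb_diff {s : ℝ} (hs : 1 < s) {E F : Set ℕ} (h : F ⊆ E) :
    zetaProb s (E \ F) = zetaProb s E - zetaProb s F := by
  have := zetaProb_inter_add_diff hs E F
  rw [inter_eq_self_of_subset_right h] at this
  linarith

theorem zetaProb_union_le {s : ℝ} (hs : 1 < s) (E F : Set ℕ) :
    zetaProb s (E ∪ F) ≤ zetaProb s E + zetaProb s F := by
  have h := zetaProb_inter_add_diff hs (E ∪ F) E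
  rw [inter_eq_self_of_subset_right subset_union_left, union_sdiff_left] at h
  linarith [zetaProb_mono hs (sdiff_subset : F \ E ⊆ F)]

theorem zetaProb_empty (s : ℝ) : zetaProb s ∅ = 0 := by simp [zetaProb, zetaMass]

theorem zetaProb_biUnion_le {ι : Type*} {s : ℝ} (hs : 1 < s) (A : Finset ι) (E : ι → Set ℕ) :
    zetaProb s (⋃ a ∈ A, E a) ≤ ∑ a ∈ A, zetaProb s (E a) := by
  classical
  induction A using Finset.induction_on with
  | empty => simp [zetaProb_empty]
  | insert a A ha ih =>
    rw [Finset.set_biUnion_insert, Finset.sum_insert ha]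
    linarith [zetaProb_union_le hs (E a) (⋃ x ∈ A, E x)]

theorem zetaProb_dilate (s : ℝ) {c : ℕ} (hc : 0 < c) (E : Set ℕ) :
    zetaProb s {n | c ∣ n ∧ n ∈ E} = (c : ℝ) ^ (-s) * zetaProb s {k | c * k ∈ E} := by
  rw [zetaProb, zetaMass_dilate s hc, zetaProb, mul_div_assoc]

theorem tendsto_natCast_rpow_neg {c : ℕ} (hc : 0 < c) :
    Tendsto (fun s : ℝ => (c : ℝ) ^ (-s)) (nhdsWithin 1 (Ioi 1)) (nhds (c : ℝ)⁻¹) := by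
  have : Tendsto (fun s : ℝ => (c : ℝ) ^ (-s)) (nhds 1) (nhds ((c : ℝ) ^ (-(1 : ℝ)))) := by
    have hc' : (c : ℝ) ≠ 0 := by positivity
    exact (Real.continuousAt_const_rpow hc').tendsto.comp (continuous_neg.tendsto 1)
  rw [Real.rpow_neg_one] at this
  exact this.mono_left nhdsWithin_le_nhds

theorem tendsto_zetaProb_shift_sub (a : ℕ) (E : Set ℕ) :
    Tendsto (fun s => zetaProb s {m | m + a ∈ E} - zetaProb s E) (nhdsWithin 1 (Ioi 1))
      (nhds 0) := by
  have h := tendsto_inv_zetaMass_univ.const_mul (a : ℝ)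
  rw [mul_zero] at h
  refine squeeze_zero_norm' ?_ h
  filter_upwards [self_mem_nhdsWithin] with s (hs : 1 < s)
  rw [zetaProb, zetaProb, ← sub_div, Real.norm_eq_abs, abs_div, abs_of_nonneg
    (zetaMass_nonneg s univ), div_eq_mul_inv]
  exact mul_le_mul_of_nonneg_right (abs_zetaMass_shift_sub_le hs a E)
    (inv_nonneg.2 (zetaMass_nonneg _ _))

theorem tendsto_zetaProb_modEq {q : ℕ} (hq : 0 < q) (r : ℕ) :
    Tendsto (fun s => zetaProb s {n | n ≡ r [MOD q]}) (nhdsWithin 1 (Ioi 1))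
      (nhds (q : ℝ)⁻¹) := by
  have h0 : Tendsto (fun s => zetaProb s {n | q ∣ n}) (nhdsWithin 1 (Ioi 1)) (nhds (q : ℝ)⁻¹) := by
    refine (tendsto_natCast_rpow_neg hq).congr' ?_
    filter_upwards [self_mem_nhdsWithin] with s (hs : 1 < s)
    have := zetaProb_dilate s hq univ
    simp only [mem_univ, and_true, ofPred_true, zetaProb_univ hs, mul_one] at this
    exact this.symm
  obtain ⟨a, ha⟩ : ∃ a, q ∣ r + a := ⟨r * (q - 1), by
    refine ⟨r, ?_⟩
    obtain ⟨q, rfl⟩ := Nat.exists_eq_succ_of_ne_zero hq.ne'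
    simp; ring⟩
  have h1 := (tendsto_zetaProb_shift_sub a {n | q ∣ n}).add h0
  simp only [sub_add_cancel, zero_add] at h1
  convert h1 using 4 with s
  ext n
  simp only [mem_ofPred_eq]
  rw [← Nat.modEq_zero_iff_dvd] at ha ⊢
  exact ⟨fun h => (h.add_right a).trans ha, fun h => Nat.ModEq.add_right_cancel' a (h.trans ha.symm)⟩

theorem tendsto_zetaProb_finite {E : Set ℕ} (hE : E.Finite) :
    Tendsto (fun s => zetaProb s E) (nhdsWithin 1 (Ioi 1)) (nhds 0) := by
  obtain ⟨a, ha⟩ := hE.bddAbove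
  have h := (tendsto_zetaProb_shift_sub (a + 1) E).neg
  rw [neg_zero] at h
  refine h.congr fun s => ?_
  have : {m | m + (a + 1) ∈ E} = ∅ := by
    ext m
    simp only [mem_ofPred_eq, mem_empty_iff_false, iff_false]
    intro hm
    have := ha hm
    omega
  rw [this, zetaProb_empty]
  ring

end zetaProb

open ArithmeticFunction in
theorem exists_nonneg_sum_divisors_eq_rpow {c : ℝ} (hc : 0 < c) :
    ∃ g : ℕ → ℝ, (∀ n, 0 ≤ g n) ∧ ∀ n : ℕ, 0 < n → ∑ k ∈ n.divisors, g k = (n : ℝ) ^ c := by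
  let f : ArithmeticFunction ℝ := ⟨fun n => (n : ℝ) ^ c, by simp [Real.zero_rpow hc.ne']⟩
  have hf : f.IsMultiplicative := by
    rw [IsMultiplicative.iff_ne_zero]
    refine ⟨by simp [f], fun {m n} _ _ _ => ?_⟩
    simp [f, Real.mul_rpow]
  let g : ArithmeticFunction ℝ := (moebius : ArithmeticFunction ℝ) * f
  have hg : g.IsMultiplicative := (isMultiplicative_moebius.intCast).mul hf
  have hfg : g * (zeta : ArithmeticFunction ℝ) = f := by
    rw [mul_comm, ← mul_assoc, coe_zeta_mul_coe_moebius, one_mul]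
  have hsum : ∀ n : ℕ, ∑ k ∈ n.divisors, g k = (n : ℝ) ^ c := fun n => by
    rw [← coe_mul_zeta_apply, hfg]; rfl
  refine ⟨g, fun n => ?_, fun n _ => hsum n⟩
  rcases eq_or_ne n 0 with rfl | hn
  · simp
  rw [IsMultiplicative.multiplicative_factorization g hg hn]
  refine Finset.prod_nonneg fun p hp => ?_
  have hpp : p.Prime := Nat.prime_of_mem_primeFactors hp
  obtain ⟨k, hk⟩ : ∃ k, n.factorization p = k + 1 :=
    Nat.exists_eq_succ_of_ne_zero (Finsupp.mem_support_iff.1 hp)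
  simp only [hk]
  have h1 := hsum (p ^ (k + 1))
  have h2 := hsum (p ^ k)
  rw [Nat.sum_divisors_prime_pow hpp] at h1 h2
  rw [Finset.sum_range_succ, h2] at h1
  have : ((p ^ k : ℕ) : ℝ) ^ c ≤ ((p ^ (k + 1) : ℕ) : ℝ) ^ c := by
    refine Real.rpow_le_rpow (by positivity) ?_ hc.le
    exact_mod_cast Nat.pow_le_pow_right hpp.pos k.le_succ
  linarith

/-- The mass of `E` as an extended nonnegative real. -/
theorem ofReal_zetaMass {s : ℝ} (hs : 1 < s) (E : Set ℕ) :
    ENNReal.ofReal (zetaMass s E) =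
      ∑' n : ℕ, ENNReal.ofReal (E.indicator (fun n : ℕ => (n : ℝ) ^ (-s)) n) :=
  ENNReal.ofReal_tsum_of_nonneg (zetaWeight_nonneg s E) (summable_zetaMass hs E)

theorem ofReal_zetaMass_eq_tsum_divisors {s t : ℝ} (hs : 1 < s) (hst : s < t) {g : ℕ → ℝ}
    (hg0 : ∀ n, 0 ≤ g n)
    (hg : ∀ n : ℕ, 0 < n → ∑ k ∈ n.divisors, g k = (n : ℝ) ^ (t - s)) (E : Set ℕ) :
    ENNReal.ofReal (zetaMass s E) =
      ∑' k : ℕ, ENNReal.ofReal (g k) * ENNReal.ofReal (zetaMass t {n | k ∣ n ∧ n ∈ E}) := by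
  classical
  have ht : 1 < t := hs.trans hst
  simp_rw [ofReal_zetaMass ht, ← ENNReal.tsum_mul_left]
  rw [ENNReal.tsum_comm, ofReal_zetaMass hs]
  congr 1
  ext n
  rcases Nat.eq_zero_or_pos n with rfl | hn
  · have h1 : ∀ F : Set ℕ, F.indicator (fun n : ℕ => (n : ℝ) ^ (-s)) 0 = 0 := fun F => by
      simp [indicator, Real.zero_rpow (show -s ≠ 0 by linarith)]
    have h2 : ∀ F : Set ℕ, F.indicator (fun n : ℕ => (n : ℝ) ^ (-t)) 0 = 0 := fun F => by
      simp [indicator, Real.zero_rpow (show -t ≠ 0 by linarith)]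
    simp only [h1, h2, ENNReal.ofReal_zero, mul_zero, tsum_zero]
  · rw [tsum_eq_sum (s := n.divisors)]
    · by_cases hE : n ∈ E
      · rw [indicator_of_mem hE]
        have : ∀ k ∈ n.divisors, ENNReal.ofReal (g k) *
            ENNReal.ofReal (({n | k ∣ n ∧ n ∈ E} : Set ℕ).indicator
              (fun n : ℕ => (n : ℝ) ^ (-t)) n) = ENNReal.ofReal (g k * (n : ℝ) ^ (-t)) := by
          intro k hk
          rw [indicator_of_mem (show n ∈ {n | k ∣ n ∧ n ∈ E} from
            ⟨Nat.dvd_of_mem_divisors hk, hE⟩), ENNReal.ofReal_mul (hg0 k)]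
        rw [Finset.sum_congr rfl this, ← ENNReal.ofReal_sum_of_nonneg
          (fun k _ => mul_nonneg (hg0 k) (by positivity)), ← Finset.sum_mul, hg n hn,
          ← Real.rpow_add (by exact_mod_cast hn)]
        congr 2; ring
      · have : ∀ k : ℕ, n ∉ {n | k ∣ n ∧ n ∈ E} := fun k h => hE h.2
        simp [indicator_of_notMem hE, indicator_of_notMem (this _)]
    · intro k hk
      have : n ∉ {n | k ∣ n ∧ n ∈ E} := fun h =>
        hk (Nat.mem_divisors.2 ⟨h.1, hn.ne'⟩)
      simp [indicator_of_notMem this]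

/-- The set of multiples of elements of `C`, within the natural numbers. -/
def natMultiples (C : Set ℕ) : Set ℕ := {n | ∃ c ∈ C, c ∣ n}

theorem natMultiples_mono {C D : Set ℕ} (h : C ⊆ D) : natMultiples C ⊆ natMultiples D :=
  fun _ ⟨c, hc, hn⟩ => ⟨c, h hc, hn⟩

theorem mul_mem_natMultiples {C : Set ℕ} {n : ℕ} (k : ℕ) (hn : n ∈ natMultiples C) :
    k * n ∈ natMultiples C :=
  let ⟨c, hc, hcn⟩ := hn
  ⟨c, hc, hcn.mul_left k⟩

theorem zetaProb_natMultiples_anti (C : Set ℕ) :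
    AntitoneOn (fun s => zetaProb s (natMultiples C)) (Ioi 1) := by
  intro s hs t ht hst
  simp only [mem_Ioi] at hs ht
  rcases hst.eq_or_lt with rfl | hst
  · exact le_rfl
  obtain ⟨g, hg0, hg⟩ := exists_nonneg_sum_divisors_eq_rpow (sub_pos.2 hst)
  have key := ofReal_zetaMass_eq_tsum_divisors hs hst hg0 hg
  have h0 : ∀ E : Set ℕ, zetaMass t {n | 0 ∣ n ∧ n ∈ E} = 0 := by
    intro E
    have : ({n | 0 ∣ n ∧ n ∈ E} : Set ℕ).indicator (fun n : ℕ => (n : ℝ) ^ (-t)) = 0 := by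
      ext n
      rw [Pi.zero_apply, indicator_apply_eq_zero]
      rintro ⟨h, -⟩
      rw [zero_dvd_iff.1 h]
      simp [Real.zero_rpow (show -t ≠ 0 by linarith)]
    rw [zetaMass, this]
    exact tsum_zero
  have h1 : ∀ k : ℕ, zetaMass t {n | k ∣ n ∧ n ∈ univ} * zetaMass t (natMultiples C) ≤
      zetaMass t {n | k ∣ n ∧ n ∈ natMultiples C} * zetaMass t univ := by
    intro k
    rcases Nat.eq_zero_or_pos k with rfl | hk
    · rw [h0, h0, zero_mul, zero_mul]
    · rw [zetaMass_dilate t hk, zetaMass_dilate t hk]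
      have : zetaMass t (natMultiples C) ≤ zetaMass t {m | k * m ∈ natMultiples C} :=
        zetaMass_mono ht fun m hm => mul_mem_natMultiples k hm
      have e : ({m | k * m ∈ univ} : Set ℕ) = univ := by simp
      rw [e, mul_assoc, mul_assoc, mul_comm (zetaMass t univ)]
      gcongr
      exact zetaMass_nonneg _ _
  have h2 : zetaMass s univ * zetaMass t (natMultiples C) ≤
      zetaMass s (natMultiples C) * zetaMass t univ := by
    rw [← ENNReal.ofReal_le_ofReal_iff (mul_nonneg (zetaMass_nonneg _ _) (zetaMass_nonneg _ _)),
      ENNReal.ofReal_mul (zetaMass_nonneg _ _), ENNReal.ofReal_mul (zetaMass_nonneg _ _),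
      key, key, ← ENNReal.tsum_mul_right, ← ENNReal.tsum_mul_right]
    refine ENNReal.tsum_le_tsum fun k => ?_
    rw [mul_assoc, mul_assoc, ← ENNReal.ofReal_mul (zetaMass_nonneg _ _),
      ← ENNReal.ofReal_mul (zetaMass_nonneg _ _)]
    exact mul_le_mul_right (ENNReal.ofReal_le_ofReal (h1 k)) _
  have ps := one_le_zetaMass_univ hs
  have pt := one_le_zetaMass_univ ht
  simp only [zetaProb]
  rw [div_le_div_iff₀ (by linarith) (by linarith)]
  linarith

/-- The density of the set of multiples of `C`. -/
noncomputable def multDensity (C : Set ℕ) : ℝ :=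
  sSup ((fun s => zetaProb s (natMultiples C)) '' Ioi 1)

theorem bddAbove_zetaProb (E : Set ℕ) : BddAbove ((fun s => zetaProb s E) '' Ioi 1) :=
  ⟨1, by rintro _ ⟨s, hs, rfl⟩; exact zetaProb_le_one hs E⟩

theorem tendsto_zetaProb_natMultiples (C : Set ℕ) :
    Tendsto (fun s => zetaProb s (natMultiples C)) (nhdsWithin 1 (Ioi 1))
      (nhds (multDensity C)) :=
  (zetaProb_natMultiples_anti C).tendsto_nhdsGT (bddAbove_zetaProb _)

theorem tendsto_zetaProb_compl_natMultiples (C : Set ℕ) :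
    Tendsto (fun s => zetaProb s (natMultiples C)ᶜ) (nhdsWithin 1 (Ioi 1))
      (nhds (1 - multDensity C)) := by
  refine ((tendsto_zetaProb_natMultiples C).const_sub 1).congr' ?_
  filter_upwards [self_mem_nhdsWithin] with s (hs : 1 < s)
  rw [zetaProb_compl hs]

theorem zetaProb_le_multDensity {s : ℝ} (hs : 1 < s) (C : Set ℕ) :
    zetaProb s (natMultiples C) ≤ multDensity C :=
  le_csSup (bddAbove_zetaProb _) ⟨s, hs, rfl⟩

theorem multDensity_le_of_forall {C : Set ℕ} {x : ℝ}
    (h : ∀ s, 1 < s → zetaProb s (natMultiples C) ≤ x) : multDensity C ≤ x :=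
  csSup_le ⟨_, 2, by norm_num, rfl⟩ (by rintro _ ⟨s, hs, rfl⟩; exact h s hs)

theorem multDensity_nonneg (C : Set ℕ) : 0 ≤ multDensity C :=
  (zetaProb_nonneg 2 _).trans (zetaProb_le_multDensity (by norm_num) C)

theorem multDensity_le_one (C : Set ℕ) : multDensity C ≤ 1 :=
  multDensity_le_of_forall fun _ hs => zetaProb_le_one hs _

theorem multDensity_mono {C D : Set ℕ} (h : C ⊆ D) : multDensity C ≤ multDensity D :=
  multDensity_le_of_forall fun _ hs =>
    (zetaProb_mono hs (natMultiples_mono h)).trans (zetaProb_le_multDensity hs D)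

theorem multDensity_biUnion_le {ι : Type*} (A : Finset ι) (C : ι → Set ℕ) :
    multDensity (⋃ a ∈ A, C a) ≤ ∑ a ∈ A, multDensity (C a) := by
  refine multDensity_le_of_forall fun s hs => ?_
  have : natMultiples (⋃ a ∈ A, C a) ⊆ ⋃ a ∈ A, natMultiples (C a) := by
    rintro n ⟨c, hc, hn⟩
    simp only [mem_iUnion] at hc ⊢
    obtain ⟨a, ha, hc⟩ := hc
    exact ⟨a, ha, c, hc, hn⟩
  refine (zetaProb_mono hs this).trans ((zetaProb_biUnion_le hs A _).trans ?_)
  exact Finset.sum_le_sum fun a _ => zetaProb_le_multDensity hs (C a)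

theorem multDensity_empty : multDensity ∅ = 0 := by
  refine le_antisymm (multDensity_le_of_forall fun s _ => ?_) (multDensity_nonneg _)
  simp [natMultiples, zetaProb_empty]

/-- The density of a set of multiples is approximated by finite subsets. -/
theorem exists_finset_multDensity (C : Set ℕ) {ε : ℝ} (hε : 0 < ε) :
    ∃ F : Finset ℕ, (F : Set ℕ) ⊆ C ∧ multDensity C - ε < multDensity F := by
  classical
  obtain ⟨_, ⟨s, hs, rfl⟩, h1⟩ := exists_lt_of_lt_csSup
    (⟨_, 2, by norm_num, rfl⟩ : ((fun s => zetaProb s (natMultiples C)) '' Ioi 1).Nonempty)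
    (show multDensity C - ε < multDensity C by linarith)
  simp only [mem_Ioi] at hs h1
  have hZ := one_le_zetaMass_univ hs
  rw [zetaProb, lt_div_iff₀ (by linarith)] at h1
  obtain ⟨S, hS⟩ := ((summable_zetaMass hs (natMultiples C)).hasSum.eventually
    (lt_mem_nhds h1)).exists
  have : ∀ n, ∃ c, n ∈ natMultiples C → c ∈ C ∧ c ∣ n := fun n => by
    by_cases h : n ∈ natMultiples C
    · obtain ⟨c, hc⟩ := h
      exact ⟨c, fun _ => hc⟩
    · exact ⟨0, fun h' => absurd h' h⟩
  choose d hd using this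
  let F := (S.filter (· ∈ natMultiples C)).image d
  refine ⟨F, ?_, ?_⟩
  · intro c hc
    simp only [F, Finset.coe_image, Finset.coe_filter, mem_image, mem_ofPred_eq] at hc
    obtain ⟨n, ⟨-, hn⟩, rfl⟩ := hc
    exact (hd n hn).1
  · refine lt_of_lt_of_le ?_ (zetaProb_le_multDensity hs F)
    rw [zetaProb, lt_div_iff₀ (by linarith)]
    refine hS.trans_le (le_trans ?_ ((summable_zetaMass hs (natMultiples F)).sum_le_tsum S
      fun n _ => zetaWeight_nonneg _ _ _))
    refine Finset.sum_le_sum fun n hn => ?_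
    by_cases h : n ∈ natMultiples C
    · have h' : n ∈ natMultiples F := ⟨d n, Finset.mem_coe.2 (Finset.mem_image.2
        ⟨n, Finset.mem_filter.2 ⟨hn, h⟩, rfl⟩), (hd n h).2⟩
      rw [indicator_of_mem h, indicator_of_mem h']
    · rw [indicator_of_notMem h]
      exact zetaWeight_nonneg _ _ _

theorem dvd_mul_iff_div_gcd_dvd {c : ℕ} (hc : 0 < c) (f k : ℕ) :
    f ∣ c * k ↔ f / f.gcd c ∣ k := by
  obtain ⟨g, f', c', hg, hcop, rfl, rfl⟩ := Nat.exists_coprime' (Nat.gcd_pos_of_pos_right f hc)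
  have hcop' : (f' * g).gcd (c' * g) = g := by rw [Nat.gcd_mul_right, hcop.gcd_eq_one, one_mul]
  rw [hcop', Nat.mul_div_cancel _ hg, mul_comm f', mul_comm c', mul_assoc,
    Nat.mul_dvd_mul_iff_left hg, hcop.dvd_mul_left]

/-- The set of `c / gcd c d` for `c ∈ C`: its multiples are the `k` with `d * k` a multiple of
an element of `C`. -/
def gcdQuotient (d : ℕ) (C : Set ℕ) : Set ℕ := (fun c => c / c.gcd d) '' C

theorem mul_mem_natMultiples_iff {d : ℕ} (hd : 0 < d) {C : Set ℕ} {k : ℕ} :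
    d * k ∈ natMultiples C ↔ k ∈ natMultiples (gcdQuotient d C) := by
  simp only [natMultiples, gcdQuotient, mem_ofPred_eq, exists_mem_image,
    dvd_mul_iff_div_gcd_dvd hd]

theorem gcdQuotient_eq_self {d : ℕ} {C : Set ℕ} (h : ∀ c ∈ C, c.Coprime d) :
    gcdQuotient d C = C := by
  ext x
  constructor
  · rintro ⟨c, hc, rfl⟩
    simpa [(h c hc).gcd_eq_one] using hc
  · intro hx
    exact ⟨x, hx, by simp [(h x hx).gcd_eq_one]⟩

theorem zetaProb_compl_insert_inter {s : ℝ} (hs : 1 < s) {c : ℕ} (hc : 0 < c) (F G : Set ℕ) :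
    zetaProb s ((natMultiples (insert c F))ᶜ ∩ G) = zetaProb s ((natMultiples F)ᶜ ∩ G) -
      (c : ℝ) ^ (-s) * zetaProb s ((natMultiples (gcdQuotient c F))ᶜ ∩ {k | c * k ∈ G}) := by
  have h1 := zetaProb_inter_add_diff hs ((natMultiples F)ᶜ ∩ G) {n | c ∣ n}
  have h2 := zetaProb_dilate s hc ((natMultiples F)ᶜ ∩ G)
  have e1 : ((natMultiples F)ᶜ ∩ G) ∩ {n | c ∣ n} = {n | c ∣ n ∧ n ∈ (natMultiples F)ᶜ ∩ G} := by
    ext n; simp only [mem_inter_iff, mem_ofPred_eq]; tauto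
  have e2 : ((natMultiples F)ᶜ ∩ G) \ {n | c ∣ n} = (natMultiples (insert c F))ᶜ ∩ G := by
    ext n
    simp only [natMultiples, Set.mem_sdiff, mem_inter_iff, mem_compl_iff, mem_ofPred_eq,
      exists_mem_insert, not_or]
    tauto
  have e3 : {k | c * k ∈ (natMultiples F)ᶜ ∩ G} =
      (natMultiples (gcdQuotient c F))ᶜ ∩ {k | c * k ∈ G} := by
    ext k
    simp only [mem_inter_iff, mem_compl_iff, mem_ofPred_eq, mul_mem_natMultiples_iff hc]
  rw [e1, e2, h2, e3] at h1
  linarith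

theorem gcdQuotient_finset (c : ℕ) (F : Finset ℕ) :
    gcdQuotient c F = (F.image (fun f => f / f.gcd c) : Finset ℕ) := by
  simp [gcdQuotient]

theorem ne_zero_of_mem_gcdQuotient {c : ℕ} {F : Set ℕ} (hF : ∀ f ∈ F, f ≠ 0) {x : ℕ}
    (hx : x ∈ gcdQuotient c F) : x ≠ 0 := by
  obtain ⟨f, hf, rfl⟩ := hx
  have h := Nat.pos_of_ne_zero (hF f hf)
  exact (Nat.div_pos (Nat.gcd_le_left c h) (Nat.gcd_pos_of_pos_left c h)).ne'

theorem coprime_of_mem_gcdQuotient {c m : ℕ} {F : Set ℕ} (hF : ∀ f ∈ F, f.Coprime m) {x : ℕ}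
    (hx : x ∈ gcdQuotient c F) : x.Coprime m := by
  obtain ⟨f, hf, rfl⟩ := hx
  exact (hF f hf).coprime_dvd_left (Nat.div_dvd_of_dvd (Nat.gcd_dvd_left f c))

/-- Sets of multiples of coprime sets are independent under the zeta distribution. -/
theorem zetaProb_compl_inter_of_coprime {s : ℝ} (hs : 1 < s) (F : Finset ℕ) (H : Set ℕ)
    (hF : ∀ f ∈ F, f ≠ 0) (hFH : ∀ h ∈ H, ∀ f ∈ F, f.Coprime h) :
    zetaProb s ((natMultiples F)ᶜ ∩ (natMultiples H)ᶜ) =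
      zetaProb s (natMultiples F)ᶜ * zetaProb s (natMultiples H)ᶜ := by
  classical
  induction hn : F.card using Nat.strong_induction_on generalizing F with
  | _ n ih =>
    rcases F.eq_empty_or_nonempty with rfl | ⟨c, hc⟩
    · have : (natMultiples ((∅ : Finset ℕ) : Set ℕ))ᶜ = univ := by simp [natMultiples]
      rw [this, univ_inter, zetaProb_univ hs, one_mul]
    have hc0 : 0 < c := Nat.pos_of_ne_zero (hF c hc)
    set F' := F.erase c with hF'
    have hsub : ∀ f ∈ F', f ∈ F := fun f hf => Finset.mem_of_mem_erase hf
    have hlt : F'.card < n := hn ▸ Finset.card_erase_lt_of_mem hc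
    have hins : (F : Set ℕ) = insert c (F' : Set ℕ) := by
      rw [← Finset.coe_insert, Finset.insert_erase hc]
    have hH : {k | c * k ∈ (natMultiples H)ᶜ} = (natMultiples H)ᶜ := by
      ext k
      rw [mem_ofPred_eq, mem_compl_iff, mem_compl_iff, mul_mem_natMultiples_iff hc0,
        gcdQuotient_eq_self fun h hh => (hFH h hh c hc).symm]
    have h1 := ih _ hlt F' (fun f hf => hF f (hsub f hf)) (fun h hh f hf => hFH h hh f (hsub f hf))
      rfl
    have hq := gcdQuotient_finset c F'
    have h2 := ih _ (Finset.card_image_le.trans_lt hlt) (F'.image (fun f => f / f.gcd c))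
      (fun x hx => ne_zero_of_mem_gcdQuotient (fun f hf => hF f (hsub f hf))
        (hq ▸ Finset.mem_coe.2 hx))
      (fun h hh x hx => coprime_of_mem_gcdQuotient (fun f hf => hFH h hh f (hsub f hf))
        (hq ▸ Finset.mem_coe.2 hx)) rfl
    have e1 := zetaProb_compl_insert_inter hs hc0 F' (natMultiples H)ᶜ
    have e2 := zetaProb_compl_insert_inter hs hc0 F' univ
    simp only [inter_univ, mem_univ, ofPred_true] at e2
    rw [hins, e1, e2, hH, hq, h1, h2]
    ring

/-- Sets of multiples are asymptotically independent of residue classes to coprime moduli. -/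
theorem tendsto_zetaProb_compl_inter_modEq (F : Finset ℕ) (q r : ℕ) (hq : 0 < q)
    (hF : ∀ f ∈ F, f ≠ 0) (hFq : ∀ f ∈ F, f.Coprime q) :
    Tendsto (fun s => zetaProb s ((natMultiples F)ᶜ ∩ {n | n ≡ r [MOD q]}))
      (nhdsWithin 1 (Ioi 1)) (nhds ((1 - multDensity F) / q)) := by
  classical
  induction hn : F.card using Nat.strong_induction_on generalizing F r with
  | _ n ih =>
    rcases F.eq_empty_or_nonempty with rfl | ⟨c, hc⟩
    · have : (natMultiples ((∅ : Finset ℕ) : Set ℕ))ᶜ = univ := by simp [natMultiples]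
      simp only [this, univ_inter]
      simpa [multDensity_empty] using tendsto_zetaProb_modEq hq r
    have hc0 : 0 < c := Nat.pos_of_ne_zero (hF c hc)
    set F' := F.erase c with hF'
    have hsub : ∀ f ∈ F', f ∈ F := fun f hf => Finset.mem_of_mem_erase hf
    have hlt : F'.card < n := hn ▸ Finset.card_erase_lt_of_mem hc
    have hins : (F : Set ℕ) = insert c (F' : Set ℕ) := by
      rw [← Finset.coe_insert, Finset.insert_erase hc]
    obtain ⟨r', hr'⟩ : ∃ r', r ≡ c * r' [MOD q] := by
      obtain ⟨m, hm⟩ := Nat.exists_mul_mod_eq_of_coprime r (hFq c hc) hq.ne'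
      exact ⟨m, hm.2.symm⟩
    have hG : {k | c * k ∈ {n | n ≡ r [MOD q]}} = {k | k ≡ r' [MOD q]} := by
      ext k
      simp only [mem_ofPred_eq]
      exact ⟨fun h => Nat.ModEq.cancel_left_of_coprime (hFq c hc).symm (h.trans hr'),
        fun h => (h.mul_left c).trans hr'.symm⟩
    have h1 := ih _ hlt F' r (fun f hf => hF f (hsub f hf)) (fun f hf => hFq f (hsub f hf)) rfl
    have hquo := gcdQuotient_finset c F'
    have h2 := ih _ (Finset.card_image_le.trans_lt hlt) (F'.image (fun f => f / f.gcd c)) r'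
      (fun x hx => ne_zero_of_mem_gcdQuotient (fun f hf => hF f (hsub f hf))
        (hquo ▸ Finset.mem_coe.2 hx))
      (fun x hx => coprime_of_mem_gcdQuotient (fun f hf => hFq f (hsub f hf))
        (hquo ▸ Finset.mem_coe.2 hx)) rfl
    rw [← hquo] at h2
    have hd : 1 - multDensity F = (1 - multDensity F') -
        (c : ℝ)⁻¹ * (1 - multDensity (gcdQuotient c F')) := by
      refine tendsto_nhds_unique (tendsto_zetaProb_compl_natMultiples F)
        (((tendsto_zetaProb_compl_natMultiples F').sub ((tendsto_natCast_rpow_neg hc0).mul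
          (tendsto_zetaProb_compl_natMultiples (gcdQuotient c F')))).congr' ?_)
      filter_upwards [self_mem_nhdsWithin] with s (hs : 1 < s)
      have e2 := zetaProb_compl_insert_inter hs hc0 F' univ
      simp only [inter_univ, mem_univ, ofPred_true] at e2
      rw [hins, e2]
    have h3 := h1.sub ((tendsto_natCast_rpow_neg hc0).mul h2)
    rw [hd, sub_div, mul_div_assoc]
    refine h3.congr' ?_
    filter_upwards [self_mem_nhdsWithin] with s (hs : 1 < s)
    rw [hins, zetaProb_compl_insert_inter hs hc0, hG]

/-- Upper bound for the multiples of a set coprime to `q` within a residue class modulo `q`. -/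
theorem eventually_zetaProb_inter_modEq_le (C : Set ℕ) (q r : ℕ) (hq : 0 < q)
    (hC : ∀ c ∈ C, c ≠ 0) (hCq : ∀ c ∈ C, c.Coprime q) {ε : ℝ} (hε : 0 < ε) :
    ∀ᶠ s in nhdsWithin 1 (Ioi 1),
      zetaProb s (natMultiples C ∩ {n | n ≡ r [MOD q]}) ≤ multDensity C / q + ε := by
  obtain ⟨F, hFC, hF⟩ := exists_finset_multDensity C (half_pos hε)
  have h1 := tendsto_zetaProb_compl_inter_modEq F q r hq (fun f hf => hC f (hFC hf))
    (fun f hf => hCq f (hFC hf))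
  have h2 := tendsto_zetaProb_modEq hq r
  have h3 := tendsto_zetaProb_natMultiples F
  have hlim := (h2.sub h1).add (h3.const_sub (multDensity C))
  have hq' : (0 : ℝ) < q := by exact_mod_cast hq
  have hle : (q : ℝ)⁻¹ - (1 - multDensity F) / q + (multDensity C - multDensity F) <
      multDensity C / q + ε := by
    have : multDensity F / q ≤ multDensity C / q := by
      gcongr; exact multDensity_mono hFC
    rw [sub_div, one_div]
    linarith
  filter_upwards [hlim.eventually_lt_const hle, self_mem_nhdsWithin] with s hs (h1s : 1 < s)
  refine le_trans ?_ hs.le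
  have hsub : natMultiples C ∩ {n | n ≡ r [MOD q]} ⊆
      ({n | n ≡ r [MOD q]} \ ((natMultiples F)ᶜ ∩ {n | n ≡ r [MOD q]})) ∪
        (natMultiples C \ natMultiples F) := by
    rintro n ⟨hn1, hn2⟩
    by_cases h : n ∈ natMultiples F
    · exact Or.inl ⟨hn2, fun h' => h'.1 h⟩
    · exact Or.inr ⟨hn1, h⟩
  refine (zetaProb_mono h1s hsub).trans ((zetaProb_union_le h1s _ _).trans ?_)
  rw [zetaProb_diff h1s inter_subset_right, zetaProb_diff h1s (natMultiples_mono hFC)]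
  linarith [zetaProb_le_multDensity h1s C]

theorem multDensity_eq_one_of_insert {c : ℕ} (hc : 2 ≤ c) {F : Set ℕ}
    (h : multDensity (insert c F) = 1) : multDensity F = 1 := by
  have hc0 : 0 < c := by omega
  have hle : (1 - (c : ℝ)⁻¹) * (1 - multDensity F) ≤ 1 - multDensity (insert c F) := by
    refine le_of_tendsto_of_tendsto
      ((tendsto_natCast_rpow_neg hc0).const_sub 1 |>.mul (tendsto_zetaProb_compl_natMultiples F))
      (tendsto_zetaProb_compl_natMultiples (insert c F)) ?_
    filter_upwards [self_mem_nhdsWithin] with s (hs : 1 < s)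
    have e := zetaProb_compl_insert_inter hs hc0 F univ
    simp only [inter_univ, mem_univ, ofPred_true] at e
    have : zetaProb s (natMultiples (gcdQuotient c F))ᶜ ≤ zetaProb s (natMultiples F)ᶜ := by
      refine zetaProb_mono hs (compl_subset_compl.2 fun k hk => ?_)
      exact (mul_mem_natMultiples_iff hc0).1 (mul_mem_natMultiples c hk)
    have h2 : (0 : ℝ) ≤ (c : ℝ) ^ (-s) := by positivity
    rw [e]
    nlinarith
  rw [h, sub_self] at hle
  have : (0 : ℝ) < 1 - (c : ℝ)⁻¹ := by
    have : (2 : ℝ) ≤ c := by exact_mod_cast hc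
    have := inv_lt_one_of_one_lt₀ (show (1 : ℝ) < c by linarith)
    linarith
  nlinarith [multDensity_le_one F]

/-- A zero-one law: unless the multiples of `C` have full density, the elements of `C` coprime to
a suitable integer have multiples of small density. -/
theorem exists_multDensity_coprime_lt {C : Set ℕ} (hC0 : ∀ c ∈ C, c ≠ 0) (hC : multDensity C < 1)
    {ε : ℝ} (hε : 0 < ε) : ∃ T > 0, multDensity {c ∈ C | c.Coprime T} < ε := by
  classical
  by_contra! hcon
  have hε1 : ε ≤ 1 := (hcon 1 one_pos).trans (multDensity_le_one _)
  have key : ∀ k : ℕ, ∃ F : Finset ℕ, (F : Set ℕ) ⊆ C ∧ 1 - multDensity F ≤ (1 - ε / 2) ^ k := by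
    intro k
    induction k with
    | zero => exact ⟨∅, by simp, by simp [multDensity_empty]⟩
    | succ k ih =>
      obtain ⟨F, hFC, hF⟩ := ih
      have hFpos : 0 < ∏ f ∈ F, f :=
        Nat.pos_of_ne_zero (Finset.prod_ne_zero_iff.2 fun f hf => hC0 f (hFC hf))
      obtain ⟨G, hGC, hG⟩ := exists_finset_multDensity {c ∈ C | c.Coprime (∏ f ∈ F, f)}
        (half_pos hε)
      have hG2 : ε / 2 ≤ multDensity G := by linarith [hcon _ hFpos]
      refine ⟨F ∪ G, ?_, ?_⟩
      · rw [Finset.coe_union]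
        exact union_subset hFC fun g hg => (hGC hg).1
      · have hmul : 1 - multDensity ((F ∪ G : Finset ℕ) : Set ℕ) =
            (1 - multDensity F) * (1 - multDensity G) := by
          refine tendsto_nhds_unique (tendsto_zetaProb_compl_natMultiples _)
            (((tendsto_zetaProb_compl_natMultiples F).mul
              (tendsto_zetaProb_compl_natMultiples G)).congr' ?_)
          filter_upwards [self_mem_nhdsWithin] with s (hs : 1 < s)
          rw [← zetaProb_compl_inter_of_coprime hs F G (fun f hf => hC0 f (hFC hf))
            (fun g hg f hf => ((hGC hg).2.coprime_dvd_right (Finset.dvd_prod_of_mem _ hf)).symm)]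
          congr 1
          ext n
          simp only [natMultiples, mem_inter_iff, mem_compl_iff, mem_ofPred_eq,
            Finset.coe_union, mem_union, Finset.mem_coe]
          grind
        rw [hmul, pow_succ]
        refine mul_le_mul hF (by linarith) (by linarith [multDensity_le_one G]) ?_
        exact pow_nonneg (by linarith) _
  have h1 : 0 < 1 - multDensity C := by linarith
  obtain ⟨k, hk⟩ := exists_pow_lt_of_lt_one h1 (show 1 - ε / 2 < 1 by linarith)
  obtain ⟨F, hFC, hF⟩ := key k
  linarith [multDensity_mono hFC]

/-- The logarithmic average of `E` up to `N`. -/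
noncomputable def logMean (E : Set ℕ) (N : ℕ) : ℝ :=
  (Real.log N)⁻¹ * ∑ n ∈ Finset.Icc 1 N, E.indicator (fun n : ℕ => (1 : ℝ) / n) n

theorem logWeight_nonneg (E : Set ℕ) (n : ℕ) : 0 ≤ E.indicator (fun n : ℕ => (1 : ℝ) / n) n :=
  indicator_nonneg (fun _ _ => by positivity) n

theorem logMean_nonneg (E : Set ℕ) (N : ℕ) : 0 ≤ logMean E N :=
  mul_nonneg (inv_nonneg.2 (Real.log_natCast_nonneg N))
    (Finset.sum_nonneg fun n _ => logWeight_nonneg E n)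

theorem logMean_union {E F : Set ℕ} (h : Disjoint E F) (N : ℕ) :
    logMean (E ∪ F) N = logMean E N + logMean F N := by
  rw [logMean, logMean, logMean, ← mul_add, ← Finset.sum_add_distrib]
  congr 2
  rw [indicator_union_of_disjoint h]

theorem logMean_diff {E F : Set ℕ} (h : F ⊆ E) (N : ℕ) :
    logMean (E \ F) N = logMean E N - logMean F N := by
  have := logMean_union (disjoint_sdiff_right : Disjoint F (E \ F)) N
  rw [union_sdiff_cancel h] at this
  linarith

theorem sum_logWeight_le_zetaMass {N : ℕ} (hN : 2 ≤ N) (E : Set ℕ) :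
    ∑ n ∈ Finset.Icc 1 N, E.indicator (fun n : ℕ => (1 : ℝ) / n) n ≤
      Real.exp 1 * zetaMass (1 + (Real.log N)⁻¹) E := by
  have hlog : 0 < Real.log N := Real.log_pos (by exact_mod_cast hN)
  have hs : 1 < 1 + (Real.log N)⁻¹ := by linarith [inv_pos.2 hlog]
  refine le_trans ?_ (mul_le_mul_of_nonneg_left ((summable_zetaMass hs E).sum_le_tsum
    (Finset.Icc 1 N) fun n _ => zetaWeight_nonneg _ _ _) (Real.exp_pos 1).le)
  rw [Finset.mul_sum]
  refine Finset.sum_le_sum fun n hn => ?_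
  by_cases h : n ∈ E
  · rw [indicator_of_mem h, indicator_of_mem h]
    obtain ⟨h1, h2⟩ := Finset.mem_Icc.1 hn
    have hn0 : (0 : ℝ) < n := by exact_mod_cast h1
    have hle : Real.log n * (Real.log N)⁻¹ ≤ 1 := by
      rw [← div_eq_mul_inv, div_le_one hlog]
      exact Real.log_le_log hn0 (by exact_mod_cast h2)
    rw [neg_add, Real.rpow_add hn0, Real.rpow_neg_one, Real.rpow_def_of_pos hn0, mul_left_comm,
      ← Real.exp_add, one_div]
    refine le_mul_of_one_le_right (by positivity) (Real.one_le_exp ?_)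
    rw [mul_neg]
    linarith
  · rw [indicator_of_notMem h, indicator_of_notMem h, mul_zero]

theorem eventually_logMean_le {E : Set ℕ} {ε : ℝ}
    (h : ∀ᶠ s in nhdsWithin 1 (Ioi 1), zetaProb s E ≤ ε) :
    ∀ᶠ N in atTop, logMean E N ≤ 2 * Real.exp 1 * ε := by
  have hs : Tendsto (fun N : ℕ => 1 + (Real.log N)⁻¹) atTop (nhdsWithin 1 (Ioi 1)) := by
    refine tendsto_nhdsWithin_iff.2 ⟨?_, ?_⟩
    · have := (tendsto_inv_atTop_zero.comp
        (Real.tendsto_log_atTop.comp tendsto_natCast_atTop_atTop)).const_add (1 : ℝ)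
      rwa [add_zero] at this
    · filter_upwards [eventually_ge_atTop 2] with N hN
      have : 0 < Real.log N := Real.log_pos (by exact_mod_cast hN)
      simpa using this
  have h2 := tendsto_sub_one_mul_zetaMass_univ.eventually_lt_const one_lt_two
  filter_upwards [hs.eventually h, hs.eventually h2, eventually_ge_atTop 2] with N h1 h2 hN
  have hlog : 0 < Real.log N := Real.log_pos (by exact_mod_cast hN)
  have hs1 : 1 < 1 + (Real.log N)⁻¹ := by linarith [inv_pos.2 hlog]
  have hpos : 0 < zetaMass (1 + (Real.log N)⁻¹) univ := by linarith [one_le_zetaMass_univ hs1]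
  have hε : 0 ≤ ε := (zetaProb_nonneg _ _).trans h1
  rw [zetaProb, div_le_iff₀ hpos] at h1
  rw [add_sub_cancel_left] at h2
  calc logMean E N ≤ (Real.log N)⁻¹ * (Real.exp 1 * zetaMass (1 + (Real.log N)⁻¹) E) :=
        mul_le_mul_of_nonneg_left (sum_logWeight_le_zetaMass hN E) (inv_nonneg.2 hlog.le)
    _ ≤ (Real.log N)⁻¹ * (Real.exp 1 * (ε * zetaMass (1 + (Real.log N)⁻¹) univ)) := by gcongr
    _ = ((Real.log N)⁻¹ * zetaMass (1 + (Real.log N)⁻¹) univ) * (Real.exp 1 * ε) := by ring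
    _ ≤ 2 * (Real.exp 1 * ε) := by gcongr
    _ = 2 * Real.exp 1 * ε := by ring

theorem tendsto_inv_log_natCast : Tendsto (fun N : ℕ => (Real.log N)⁻¹) atTop (nhds 0) :=
  tendsto_inv_atTop_zero.comp (Real.tendsto_log_atTop.comp tendsto_natCast_atTop_atTop)

theorem tendsto_logMean_univ : Tendsto (logMean univ) atTop (nhds 1) := by
  have hub := tendsto_inv_log_natCast.add_const (1 : ℝ)
  rw [zero_add] at hub
  have hsum : ∀ N : ℕ, ∑ n ∈ Finset.Icc 1 N, (univ : Set ℕ).indicator (fun n : ℕ => (1 : ℝ) / n) n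
      = (harmonic N : ℝ) := fun N => by
    rw [harmonic_eq_sum_Icc]
    push_cast
    simp
  refine tendsto_of_tendsto_of_tendsto_of_le_of_le' tendsto_const_nhds hub ?_ ?_
  · filter_upwards [eventually_ge_atTop 2] with N hN
    have hlog : 0 < Real.log N := Real.log_pos (by exact_mod_cast hN)
    rw [logMean, hsum, ← div_eq_inv_mul, le_div_iff₀ hlog, one_mul]
    refine le_trans (Real.log_le_log (by positivity) ?_) (log_add_one_le_harmonic N)
    push_cast; linarith
  · filter_upwards [eventually_ge_atTop 2] with N hN
    have hlog : 0 < Real.log N := Real.log_pos (by exact_mod_cast hN)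
    rw [logMean, hsum, ← div_eq_inv_mul, div_le_iff₀ hlog, add_mul, one_mul,
      inv_mul_cancel₀ hlog.ne']
    exact harmonic_le_one_add_log N

theorem abs_sum_logWeight_dilate_sub_le {c : ℕ} (hc : 0 < c) (E : Set ℕ) (N : ℕ) :
    |∑ n ∈ Finset.Icc 1 N, ({n | c ∣ n ∧ n ∈ E} : Set ℕ).indicator (fun n : ℕ => (1 : ℝ) / n) n -
      (c : ℝ)⁻¹ * ∑ k ∈ Finset.Icc 1 N,
        ({k | c * k ∈ E} : Set ℕ).indicator (fun n : ℕ => (1 : ℝ) / n) k| ≤ 1 := by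
  classical
  set f : ℕ → ℝ := fun k =>
    (c : ℝ)⁻¹ * ({k | c * k ∈ E} : Set ℕ).indicator (fun n : ℕ => (1 : ℝ) / n) k with hf
  have h1 : ∑ n ∈ Finset.Icc 1 N,
      ({n | c ∣ n ∧ n ∈ E} : Set ℕ).indicator (fun n : ℕ => (1 : ℝ) / n) n =
      ∑ k ∈ Finset.Icc 1 (N / c), f k := by
    symm
    refine Finset.sum_of_injOn (fun k => c * k) ?_ ?_ ?_ ?_
    · intro a _ b _ h
      exact Nat.eq_of_mul_eq_mul_left hc h
    · intro k hk
      simp only [Finset.coe_Icc, mem_Icc] at hk ⊢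
      exact ⟨Nat.mul_pos hc hk.1, (Nat.mul_le_mul_left c hk.2).trans (Nat.mul_div_le N c)⟩
    · intro n hn hn'
      refine indicator_of_notMem ?_ _
      rintro ⟨⟨k, rfl⟩, -⟩
      refine hn' ⟨k, ?_, rfl⟩
      simp only [Finset.coe_Icc, mem_Icc, Finset.mem_Icc] at hn ⊢
      refine ⟨Nat.pos_of_ne_zero ?_, (Nat.le_div_iff_mul_le hc).2 (by linarith [hn.2])⟩
      rintro rfl
      simp at hn
    · intro k _
      by_cases h : c * k ∈ E
      · rw [hf, indicator_of_mem (show c * k ∈ {n | c ∣ n ∧ n ∈ E} from ⟨dvd_mul_right c k, h⟩)]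
        simp only
        rw [indicator_of_mem (show k ∈ {k | c * k ∈ E} from h)]
        push_cast
        rw [one_div, one_div, mul_inv]
      · rw [hf, indicator_of_notMem (fun h' => h h'.2)]
        simp only
        rw [indicator_of_notMem (show k ∉ {k | c * k ∈ E} from h), mul_zero]
  have hsub : Finset.Icc 1 (N / c) ⊆ Finset.Icc 1 N :=
    Finset.Icc_subset_Icc_right (Nat.div_le_self N c)
  rw [h1, Finset.mul_sum, ← Finset.sum_sdiff hsub, sub_add_cancel_right, abs_neg,
    abs_of_nonneg (Finset.sum_nonneg fun k _ =>
      mul_nonneg (by positivity) (logWeight_nonneg _ k))]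
  have hterm : ∀ k ∈ Finset.Icc 1 N \ Finset.Icc 1 (N / c), f k ≤ 1 / N := by
    intro k hk
    simp only [Finset.mem_sdiff, Finset.mem_Icc, not_and, not_le] at hk
    have hN0 : 0 < N := hk.1.1.trans hk.1.2
    have hck : N < c * k := by
      have := hk.2 hk.1.1
      rwa [Nat.div_lt_iff_lt_mul hc, mul_comm] at this
    have hb : ({k | c * k ∈ E} : Set ℕ).indicator (fun n : ℕ => (1 : ℝ) / n) k ≤ 1 / k :=
      indicator_le_self' (fun _ _ => by positivity) k
    calc f k ≤ (c : ℝ)⁻¹ * (1 / k) := mul_le_mul_of_nonneg_left hb (by positivity)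
      _ = 1 / (c * k : ℕ) := by push_cast; rw [one_div, one_div, mul_inv]
      _ ≤ 1 / N := by
        refine one_div_le_one_div_of_le (by exact_mod_cast hN0) (by exact_mod_cast hck.le)
  refine (Finset.sum_le_card_nsmul _ _ _ hterm).trans ?_
  have hcard : (Finset.Icc 1 N \ Finset.Icc 1 (N / c)).card ≤ N :=
    (Finset.card_le_card Finset.sdiff_subset).trans (by simp)
  rw [nsmul_eq_mul, mul_one_div]
  exact div_le_one_of_le₀ (by exact_mod_cast hcard) (by positivity)

theorem tendsto_logMean_dilate_sub {c : ℕ} (hc : 0 < c) (E : Set ℕ) :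
    Tendsto (fun N => logMean {n | c ∣ n ∧ n ∈ E} N - (c : ℝ)⁻¹ * logMean {k | c * k ∈ E} N)
      atTop (nhds 0) := by
  refine squeeze_zero_norm (fun N => ?_) tendsto_inv_log_natCast
  have h0 : 0 ≤ (Real.log N)⁻¹ := inv_nonneg.2 (Real.log_natCast_nonneg N)
  rw [logMean, logMean, mul_left_comm, ← mul_sub, norm_mul, Real.norm_of_nonneg h0,
    Real.norm_eq_abs]
  exact mul_le_of_le_one_right h0 (abs_sum_logWeight_dilate_sub_le hc E N)

theorem exists_tendsto_logMean_finset (F : Finset ℕ) (hF : ∀ f ∈ F, f ≠ 0) :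
    ∃ d, Tendsto (logMean (natMultiples F)ᶜ) atTop (nhds d) := by
  classical
  induction hn : F.card using Nat.strong_induction_on generalizing F with
  | _ n ih =>
    rcases F.eq_empty_or_nonempty with rfl | ⟨c, hc⟩
    · have : (natMultiples ((∅ : Finset ℕ) : Set ℕ))ᶜ = univ := by simp [natMultiples]
      exact ⟨1, this ▸ tendsto_logMean_univ⟩
    have hc0 : 0 < c := Nat.pos_of_ne_zero (hF c hc)
    set F' := F.erase c with hF'
    have hsub : ∀ f ∈ F', f ∈ F := fun f hf => Finset.mem_of_mem_erase hf
    have hlt : F'.card < n := hn ▸ Finset.card_erase_lt_of_mem hc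
    have hins : (F : Set ℕ) = insert c (F' : Set ℕ) := by
      rw [← Finset.coe_insert, Finset.insert_erase hc]
    have hq := gcdQuotient_finset c F'
    obtain ⟨d1, h1⟩ := ih _ hlt F' (fun f hf => hF f (hsub f hf)) rfl
    obtain ⟨d2, h2⟩ := ih _ (Finset.card_image_le.trans_lt hlt) (F'.image (fun f => f / f.gcd c))
      (fun x hx => ne_zero_of_mem_gcdQuotient (fun f hf => hF f (hsub f hf))
        (hq ▸ Finset.mem_coe.2 hx)) rfl
    have hdil : {k | c * k ∈ (natMultiples F')ᶜ} = (natMultiples (gcdQuotient c F'))ᶜ := by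
      ext k
      simp only [mem_compl_iff, mem_ofPred_eq, mul_mem_natMultiples_iff hc0]
    rw [← hq, ← hdil] at h2
    have h3 := (tendsto_logMean_dilate_sub hc0 (natMultiples F')ᶜ).add (h2.const_mul (c : ℝ)⁻¹)
    simp only [sub_add_cancel, zero_add] at h3
    refine ⟨_, (h1.sub h3).congr fun N => ?_⟩
    rw [← logMean_diff (fun n hn => hn.2), hins]
    congr 1
    ext n
    simp only [natMultiples, Set.mem_sdiff, mem_compl_iff, mem_ofPred_eq, exists_mem_insert, not_or]
    tauto

/-- **Davenport–Erdős theorem**: sets of multiples have a logarithmic density. -/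
theorem exists_tendsto_logMean (C : Set ℕ) (hC : ∀ c ∈ C, c ≠ 0) :
    ∃ d, Tendsto (logMean (natMultiples C)ᶜ) atTop (nhds d) := by
  refine cauchySeq_tendsto_of_complete (Metric.cauchySeq_iff'.2 fun ε hε => ?_)
  set δ := ε / (8 * Real.exp 1) with hδ
  have hδ0 : 0 < δ := by positivity
  obtain ⟨F, hFC, hF⟩ := exists_finset_multDensity C hδ0
  obtain ⟨d, hd⟩ := exists_tendsto_logMean_finset F fun f hf => hC f (hFC hf)
  have hdiff : ∀ᶠ s in nhdsWithin 1 (Ioi 1),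
      zetaProb s (natMultiples C \ natMultiples F) ≤ δ := by
    have hlim := (tendsto_zetaProb_natMultiples C).sub (tendsto_zetaProb_natMultiples F)
    filter_upwards [hlim.eventually_lt_const (show multDensity C - multDensity F < δ by linarith),
      self_mem_nhdsWithin] with s hs (h1s : 1 < s)
    rw [zetaProb_diff h1s (natMultiples_mono hFC)]
    exact hs.le
  have h1 := eventually_logMean_le hdiff
  have h2 := Metric.tendsto_atTop.1 hd (ε / 4) (by positivity)
  obtain ⟨N0, hN0⟩ := eventually_atTop.1 (h1.and (eventually_atTop.2 h2))
  have hle : 2 * Real.exp 1 * δ = ε / 4 := by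
    have := Real.exp_pos 1
    rw [hδ]; field_simp; norm_num
  have key : ∀ N ≥ N0, |logMean (natMultiples C)ᶜ N - d| < ε / 2 := by
    intro N hN
    obtain ⟨a, b⟩ := hN0 N hN
    have e : logMean (natMultiples C \ natMultiples F) N =
        logMean (natMultiples F)ᶜ N - logMean (natMultiples C)ᶜ N := by
      rw [← logMean_diff (compl_subset_compl.2 (natMultiples_mono hFC))]
      congr 1
      ext n; simp only [Set.mem_sdiff, mem_compl_iff]; tauto
    have hnn := logMean_nonneg (natMultiples C \ natMultiples F) N
    rw [hle] at a
    rw [Real.dist_eq, abs_lt] at b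
    rw [abs_lt]
    constructor <;> linarith [b.1, b.2]
  refine ⟨N0, fun N hN => ?_⟩
  have a := key N hN
  have b := key N0 le_rfl
  rw [Real.dist_eq]
  rw [abs_lt] at *
  constructor <;> linarith [a.1, a.2, b.1, b.2]

theorem natCast_mem_BFreeSet {B : Set ℕ} {n : ℕ} :
    (n : ℤ) ∈ BFreeSet B ↔ n ∉ natMultiples B := by
  simp [BFreeSet, natMultiples, Int.natCast_dvd_natCast]

theorem hasLogDensity_iff {B : Set ℕ} {d : ℝ} :
    HasLogDensity (BFreeSet B) d ↔ Tendsto (logMean (natMultiples B)ᶜ) atTop (nhds d) := by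
  classical
  unfold HasLogDensity
  refine iff_of_eq ?_
  congr 1
  ext N
  rw [logMean]
  congr 1
  refine Finset.sum_congr rfl fun n _ => ?_
  simp only [natCast_mem_BFreeSet, indicator, mem_compl_iff]

/-- A taut set contains no rescaled copy of a set whose multiples have full density. -/
theorem IsTaut.multDensity_lt_one {B : Set ℕ} (hB : ∀ b ∈ B, 2 ≤ b) (htaut : IsTaut B) {e : ℕ}
    {C : Set ℕ} (hC1 : 1 ∉ C) (hC : ∀ c ∈ C, e * c ∈ B) : multDensity C < 1 := by
  refine lt_of_le_of_ne (multDensity_le_one C) fun h1 => ?_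
  obtain ⟨c, hc⟩ : C.Nonempty := by
    rw [nonempty_iff_ne_empty]
    rintro rfl
    rw [multDensity_empty] at h1
    norm_num at h1
  have hec := hB _ (hC c hc)
  have he : 0 < e := Nat.pos_of_ne_zero (by rintro rfl; simp at hec)
  have hc2 : 2 ≤ c := by
    have h0 : c ≠ 0 := by rintro rfl; simp at hec
    have h1 : c ≠ 1 := by rintro rfl; exact hC1 hc
    omega
  have h2 : multDensity (C \ {c}) = 1 := by
    refine multDensity_eq_one_of_insert hc2 ?_
    rwa [insert_sdiff_singleton, insert_eq_of_mem hc]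
  obtain ⟨d, hd⟩ := exists_tendsto_logMean B fun b hb => by have := hB b hb; omega
  have hsubB : natMultiples (B \ {e * c}) ⊆ natMultiples B := natMultiples_mono sdiff_subset
  have hsub : natMultiples B \ natMultiples (B \ {e * c}) ⊆
      {n | e ∣ n ∧ n ∈ {n | n / e ∈ (natMultiples (C \ {c}))ᶜ}} := by
    rintro n ⟨⟨b, hb, hbn⟩, hn⟩
    have hbe : b = e * c := by
      by_contra h
      exact hn ⟨b, ⟨hb, h⟩, hbn⟩
    obtain ⟨k, rfl⟩ : e ∣ n := (hbe ▸ dvd_mul_right e c).trans hbn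
    refine ⟨dvd_mul_right e k, ?_⟩
    rw [mem_ofPred_eq, Nat.mul_div_cancel_left k he]
    rintro ⟨c', ⟨hc', hne⟩, hk⟩
    exact hn ⟨e * c', ⟨hC c' hc', fun h => hne (Nat.eq_of_mul_eq_mul_left he h)⟩,
      Nat.mul_dvd_mul_left e hk⟩
  have hzero : Tendsto (fun s => zetaProb s (natMultiples B \ natMultiples (B \ {e * c})))
      (nhdsWithin 1 (Ioi 1)) (nhds 0) := by
    have hlim := (tendsto_natCast_rpow_neg he).mul
      (tendsto_zetaProb_compl_natMultiples (C \ {c}))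
    rw [h2, sub_self, mul_zero] at hlim
    refine tendsto_of_tendsto_of_tendsto_of_le_of_le' tendsto_const_nhds hlim
      (Eventually.of_forall fun s => zetaProb_nonneg s _) ?_
    filter_upwards [self_mem_nhdsWithin] with s (hs : 1 < s)
    refine (zetaProb_mono hs hsub).trans_eq ?_
    rw [zetaProb_dilate s he]
    congr 2
    ext k
    rw [mem_ofPred_eq, mem_ofPred_eq, Nat.mul_div_cancel_left k he]
  have hlog : Tendsto (logMean (natMultiples B \ natMultiples (B \ {e * c}))) atTop (nhds 0) := by
    rw [Metric.tendsto_atTop]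
    intro ε hε
    have he1 := Real.exp_pos 1
    have := eventually_logMean_le ((hzero.eventually_lt_const
      (show 0 < ε / (4 * Real.exp 1) by positivity)).mono fun s hs => hs.le)
    obtain ⟨N0, h⟩ := eventually_atTop.1 this
    refine ⟨N0, fun N hN => ?_⟩
    rw [Real.dist_eq, sub_zero, abs_of_nonneg (logMean_nonneg _ _)]
    refine (h N hN).trans_lt ?_
    have : 2 * Real.exp 1 * (ε / (4 * Real.exp 1)) = ε / 2 := by field_simp; norm_num
    linarith
  have hd' := hd.add hlog
  rw [add_zero] at hd'
  refine lt_irrefl d (htaut (e * c) (hC c hc) d d (hasLogDensity_iff.2 hd)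
    (hasLogDensity_iff.2 (hd'.congr fun N => ?_)))
  rw [← logMean_union]
  · congr 1
    ext n
    have := @hsubB n
    simp only [mem_union, Set.mem_sdiff, mem_compl_iff]
    tauto
  · rw [disjoint_left]
    rintro n hn ⟨hn', -⟩
    exact hn hn'

/-- The members of `gcdQuotient d B` that are coprime to `T`. -/
def coprimeQuotient (B : Set ℕ) (d T : ℕ) : Set ℕ := {c ∈ gcdQuotient d B | c.Coprime T}

theorem coprimeQuotient_anti (B : Set ℕ) (d : ℕ) {T T' : ℕ} (h : T ∣ T') :
    coprimeQuotient B d T' ⊆ coprimeQuotient B d T :=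
  fun _ hc => ⟨hc.1, hc.2.coprime_dvd_right h⟩

theorem IsTaut.exists_multDensity_coprimeQuotient_lt {B : Set ℕ} (hB : ∀ b ∈ B, 2 ≤ b)
    (htaut : IsTaut B) {d : ℕ} (hd : 0 < d) (hdB : d ∉ natMultiples B) {ε : ℝ} (hε : 0 < ε) :
    ∃ T > 0, multDensity (coprimeQuotient B d T) < ε := by
  classical
  set C : ℕ → Set ℕ := fun e => {c | e * c ∈ B ∧ (e * c).gcd d = e} with hC
  have key : ∀ e ∈ d.divisors, ∃ T > 0,
      multDensity {c ∈ C e | c.Coprime T} < ε / (d.divisors.card + 1) := by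
    intro e he
    refine exists_multDensity_coprime_lt ?_ ?_ (by positivity)
    · rintro c hc rfl
      have := hB _ hc.1
      omega
    · refine htaut.multDensity_lt_one hB (e := e) ?_ fun c hc => hc.1
      intro h1
      have h2 : e ∈ B := by simpa using h1.1
      exact hdB ⟨e, h2, Nat.dvd_of_mem_divisors he⟩
  choose! T hT0 hT using key
  refine ⟨∏ e ∈ d.divisors, T e, Finset.prod_pos hT0, ?_⟩
  have hsub : coprimeQuotient B d (∏ e ∈ d.divisors, T e) ⊆
      ⋃ e ∈ d.divisors, {c ∈ C e | c.Coprime (T e)} := by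
    rintro _ ⟨⟨b, hb, rfl⟩, hcop⟩
    have he : b.gcd d ∈ d.divisors := Nat.mem_divisors.2 ⟨Nat.gcd_dvd_right b d, hd.ne'⟩
    have hbb : b.gcd d * (b / b.gcd d) = b := Nat.mul_div_cancel' (Nat.gcd_dvd_left b d)
    refine mem_iUnion₂.2 ⟨b.gcd d, he, ⟨?_, ?_⟩,
      hcop.coprime_dvd_right (Finset.dvd_prod_of_mem T he)⟩
    · simpa only [hbb] using hb
    · simp only [hbb]
  calc multDensity (coprimeQuotient B d (∏ e ∈ d.divisors, T e))
      ≤ ∑ e ∈ d.divisors, multDensity {c ∈ C e | c.Coprime (T e)} :=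
        (multDensity_mono hsub).trans (multDensity_biUnion_le _ _)
    _ ≤ ∑ _e ∈ d.divisors, ε / (d.divisors.card + 1) :=
        Finset.sum_le_sum fun e he => (hT e he).le
    _ = d.divisors.card * (ε / (d.divisors.card + 1)) := by simp
    _ < ε := by
        rw [mul_div_assoc', div_lt_iff₀ (by positivity)]
        linarith

/-- Asymptotically, at most a proportion `multDensity (coprimeQuotient B d (Q / d))`,
`d = gcd (a + m₀) Q`, of the class `m₀ mod Q` is translated by `a` into the multiples of `B`. -/
theorem eventually_zetaProb_translate_le {B : Set ℕ} (hB : ∀ b ∈ B, b ≠ 0) (a m₀ : ℕ) {Q : ℕ}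
    (hQ : 0 < Q) {ε : ℝ} (hε : 0 < ε) :
    ∀ᶠ s in nhdsWithin 1 (Ioi 1),
      zetaProb s {m | m ≡ m₀ [MOD Q] ∧ m + a ∈ natMultiples B} ≤
        multDensity (coprimeQuotient B ((m₀ + a).gcd Q) (Q / (m₀ + a).gcd Q)) / Q + ε := by
  obtain ⟨d, r, q, hd, hcop, hr, hq⟩ := Nat.exists_coprime' (Nat.gcd_pos_of_pos_right (m₀ + a) hQ)
  have hdq : (m₀ + a).gcd Q = d := by
    rw [hr, hq, Nat.gcd_mul_right, hcop.gcd_eq_one, one_mul]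
  have hq0 : 0 < q := Nat.pos_of_ne_zero fun h => by simp [h] at hq; omega
  have hQd : Q / d = q := by rw [hq, Nat.mul_div_cancel _ hd]
  rw [hdq, hQd]
  set C := coprimeQuotient B d q with hC
  set H : Set ℕ := natMultiples C ∩ {k | k ≡ r [MOD q]} with hH
  set D : Set ℕ := {n | d ∣ n ∧ n ∈ {n | n / d ∈ H}} with hD
  have hsub : {m | m ≡ m₀ [MOD Q] ∧ m + a ∈ natMultiples B} ⊆ {m | m + a ∈ D} := by
    rintro m ⟨hm, hmB⟩
    have h1 : m + a ≡ r * d [MOD q * d] := by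
      rw [← hr, ← hq]
      exact hm.add_right a
    have h2 : d ∣ m + a :=
      (h1.dvd_iff (Dvd.intro_left q rfl)).2 (Dvd.intro_left r rfl)
    obtain ⟨k, hk⟩ := h2
    have h3 : k ≡ r [MOD q] := by
      rw [hk, mul_comm d k] at h1
      exact Nat.ModEq.mul_right_cancel' hd.ne' h1
    have h4 : (m + a) / d = k := by rw [hk, Nat.mul_div_cancel_left _ hd]
    refine ⟨⟨k, hk⟩, ?_⟩
    rw [mem_ofPred_eq, h4]
    refine ⟨?_, h3⟩
    rw [hk, mul_mem_natMultiples_iff hd] at hmB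
    obtain ⟨c, hc, hck⟩ := hmB
    refine ⟨c, ⟨hc, ?_⟩, hck⟩
    have h5 : k.Coprime q := by rw [Nat.Coprime, h3.gcd_eq]; exact hcop
    exact h5.coprime_dvd_left hck
  have hev := eventually_zetaProb_inter_modEq_le C q r hq0
    (fun c hc => ne_zero_of_mem_gcdQuotient hB hc.1) (fun c hc => hc.2) (half_pos hε)
  have hsh := (tendsto_zetaProb_shift_sub a D).eventually_lt_const (half_pos hε)
  filter_upwards [hev, hsh, self_mem_nhdsWithin] with s h1 h2 hs
  have hs1 : (1 : ℝ) < s := hs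
  have h3 : zetaProb s D = (d : ℝ) ^ (-s) * zetaProb s H := by
    rw [hD, zetaProb_dilate s hd]
    congr 2
    ext k
    simp [Nat.mul_div_cancel_left _ hd]
  have hd1 : (1 : ℝ) ≤ d := by exact_mod_cast hd
  have h4 : (d : ℝ) ^ (-s) ≤ (d : ℝ)⁻¹ := by
    rw [← Real.rpow_neg_one]
    exact Real.rpow_le_rpow_of_exponent_le hd1 (by linarith)
  have h5 : zetaProb s D ≤ (d : ℝ)⁻¹ * (multDensity C / q + ε / 2) := by
    rw [h3]
    exact mul_le_mul h4 h1 (zetaProb_nonneg _ _) (by positivity)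
  have h6 : (d : ℝ)⁻¹ * (multDensity C / q + ε / 2) ≤ multDensity C / Q + ε / 2 := by
    have hq0' : (0 : ℝ) < q := by exact_mod_cast hq0
    rw [mul_add, hq]
    have : (d : ℝ)⁻¹ * (multDensity C / q) = multDensity C / ((q * d : ℕ) : ℝ) := by
      push_cast
      field_simp
    rw [this]
    have : (d : ℝ)⁻¹ * (ε / 2) ≤ ε / 2 :=
      mul_le_of_le_one_left (half_pos hε).le (inv_le_one_of_one_le₀ hd1)
    linarith
  have h7 := zetaProb_mono hs1 hsub
  linarith

theorem exists_modEq_translate_notMem {B : Set ℕ} (hB : ∀ b ∈ B, b ≠ 0) (A : Finset ℕ) (m₀ : ℕ)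
    {Q : ℕ} (hQ : 0 < Q)
    (hA : ∑ a ∈ A, multDensity (coprimeQuotient B ((m₀ + a).gcd Q) (Q / (m₀ + a).gcd Q)) < 1)
    (R : ℕ) :
    ∃ m ≥ R, m ≡ m₀ [MOD Q] ∧ ∀ a ∈ A, m + a ∉ natMultiples B := by
  by_contra! hcon
  set μ : ℕ → ℝ := fun a =>
    multDensity (coprimeQuotient B ((m₀ + a).gcd Q) (Q / (m₀ + a).gcd Q)) with hμ
  have hQ' : (0 : ℝ) < Q := by exact_mod_cast hQ
  set ε : ℝ := (1 - ∑ a ∈ A, μ a) / Q / (A.card + 3) with hεdef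
  have hε : 0 < ε := by
    have : 0 < 1 - ∑ a ∈ A, μ a := by linarith
    positivity
  have hsub : {m | m ≡ m₀ [MOD Q]} ⊆
      Iio R ∪ ⋃ a ∈ A, {m | m ≡ m₀ [MOD Q] ∧ m + a ∈ natMultiples B} := by
    intro m hm
    rcases lt_or_ge m R with h | h
    · exact Or.inl h
    · obtain ⟨a, ha, hma⟩ := hcon m h hm
      exact Or.inr (mem_iUnion₂.2 ⟨a, ha, hm, hma⟩)
  have h1 := (tendsto_zetaProb_modEq hQ m₀).eventually_const_lt
    (show (Q : ℝ)⁻¹ - ε < (Q : ℝ)⁻¹ by linarith)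
  have h2 := (tendsto_zetaProb_finite (finite_Iio R)).eventually_lt_const hε
  have h3 := (eventually_all_finset A).2 fun a _ =>
    eventually_zetaProb_translate_le hB a m₀ hQ hε
  obtain ⟨s, h1, h2, h3, hs⟩ := (h1.and (h2.and (h3.and self_mem_nhdsWithin))).exists
  have hs1 : (1 : ℝ) < s := hs
  have h4 : ∑ a ∈ A, zetaProb s {m | m ≡ m₀ [MOD Q] ∧ m + a ∈ natMultiples B} ≤
      (∑ a ∈ A, μ a) / Q + A.card * ε := by
    refine (Finset.sum_le_sum h3).trans ?_
    rw [Finset.sum_add_distrib, Finset.sum_div]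
    simp [hμ]
  have h5 := ((zetaProb_mono hs1 hsub).trans (zetaProb_union_le hs1 _ _)).trans
    (add_le_add_right (zetaProb_biUnion_le hs1 A _) _)
  have h6 : ε * (A.card + 3) = (Q : ℝ)⁻¹ - (∑ a ∈ A, μ a) / Q := by
    rw [hεdef]
    field_simp
  nlinarith

theorem IsTaut.exists_notMem_natMultiples_modEq {B : Set ℕ} (hB : ∀ b ∈ B, 2 ≤ b)
    (hprim : Primitive B) (htaut : IsTaut B) {b : ℕ} (hb : b ∈ B) {r : ℕ} (hr : ¬ b ∣ r) (R : ℕ) :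
    ∃ n ≥ R, n ≡ r [MOD b] ∧ n ∉ natMultiples B := by
  have hb2 := hB b hb
  obtain ⟨d, r', q, hd, hcop, hr', hq⟩ :=
    Nat.exists_coprime' (Nat.gcd_pos_of_pos_right r (show 0 < b by omega))
  have hq0 : q ≠ 0 := fun h => by simp [h] at hq; omega
  have hdb : d ∣ b := ⟨q, by rw [hq, mul_comm]⟩
  have hdB : d ∉ natMultiples B := by
    rintro ⟨c, hc, hcd⟩
    have := hprim c hc b hb (hcd.trans hdb)
    subst this
    exact hr (hcd.trans ⟨r', by rw [hr', mul_comm]⟩)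
  obtain ⟨T, hT0, hT⟩ := htaut.exists_multDensity_coprimeQuotient_lt hB hd hdB one_pos
  obtain ⟨p, hpT, hp, hpr⟩ := Nat.forall_exists_prime_gt_and_modEq (T + q) hq0 hcop
  have hpc : p.Coprime (q * T) := by
    refine Nat.Coprime.mul_right ?_ ?_
    · exact Nat.coprime_of_lt_prime (by omega) (by omega) hp
    · exact Nat.coprime_of_lt_prime (by omega) (by omega) hp
  have hgcd : (p * d + 0).gcd (q * T * d) = d := by
    rw [add_zero, Nat.gcd_mul_right, hpc.gcd_eq_one, one_mul]
  obtain ⟨n, hnR, hn, hnB⟩ := exists_modEq_translate_notMem (B := B)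
    (fun c hc => by have := hB c hc; omega) {0} (p * d)
    (Q := q * T * d) (by positivity) (by
      rw [Finset.sum_singleton, hgcd, Nat.mul_div_cancel _ hd]
      exact (multDensity_mono (coprimeQuotient_anti B d (Dvd.intro_left q rfl))).trans_lt hT) R
  refine ⟨n, hnR, ?_, by simpa using hnB⟩
  have h1 : n ≡ p * d [MOD q * d] := hn.of_dvd ⟨T, by ring⟩
  rw [hq, hr']
  exact h1.trans (hpr.mul_right' d)

theorem exists_seq_coprime {B : Set ℕ} (hB : ∀ T > 0, ∃ b ∈ B, b.Coprime T)
    (hB2 : ∀ b ∈ B, 2 ≤ b) {W : ℕ} (hW : 0 < W) :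
    ∃ f : ℕ → ℕ, (∀ n, f n ∈ B ∧ (f n).Coprime W) ∧
      Pairwise (Function.onFun Nat.Coprime f) := by
  have : Std.Symm Nat.Coprime := ⟨fun _ _ h => h.symm⟩
  refine exists_seq_of_forall_finset_exists' (fun b => b ∈ B ∧ b.Coprime W) Nat.Coprime ?_
  intro s hs
  obtain ⟨b, hb, hcop⟩ := hB (W * ∏ x ∈ s, x) (Nat.mul_pos hW
    (Finset.prod_pos fun x hx => by have := hB2 x (hs x hx).1; omega))
  refine ⟨b, ⟨hb, hcop.coprime_mul_right_right⟩, fun x hx => ?_⟩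
  exact (hcop.coprime_mul_left_right.coprime_dvd_right (Finset.dvd_prod_of_mem _ hx)).symm

theorem IsTaut.exists_window {B : Set ℕ} (hB : ∀ b ∈ B, 2 ≤ b) (htaut : IsTaut B)
    (hcop : ∀ T > 0, ∃ b ∈ B, b.Coprime T) {m : ℤ} {L : ℕ} {A : Finset ℕ}
    (hA : ∀ a ∈ A, a < L ∧ m + a ∈ BFreeSet B) :
    ∃ t : ℕ, ∀ n < L, t + n ∈ natMultiples B ↔ n ∉ A := by
  classical
  have hX : ∀ a ∈ A, 0 < (m + a).natAbs ∧ (m + a).natAbs ∉ natMultiples B := by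
    intro a ha
    refine ⟨Int.natAbs_pos.2 fun h0 => ?_, fun ⟨b, hb, hba⟩ => ?_⟩
    · obtain ⟨b, hb, -⟩ := hcop 1 one_pos
      exact (hA a ha).2 b hb (h0 ▸ dvd_zero _)
    · exact (hA a ha).2 b hb (Int.natCast_dvd.2 hba)
  have key : ∀ a ∈ A, ∃ T > 0,
      multDensity (coprimeQuotient B (m + a).natAbs T) < 1 / (A.card + 1) := fun a ha =>
    htaut.exists_multDensity_coprimeQuotient_lt hB (hX a ha).1 (hX a ha).2 (by positivity)
  choose! T hT0 hT using key
  set K := ∏ a ∈ A, (m + a).natAbs * T a with hK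
  have hK0 : 0 < K := Finset.prod_pos fun a ha => Nat.mul_pos (hX a ha).1 (hT0 a ha)
  have hXK : ∀ a ∈ A, (m + a).natAbs * T a ∣ K := fun a ha => Finset.dvd_prod_of_mem
    (fun a : ℕ => (m + a).natAbs * T a) ha
  obtain ⟨b, hb, hbb⟩ := exists_seq_coprime hcop hB (Nat.mul_pos hK0 (Nat.factorial_pos L))
  set I := Finset.range L \ A with hI
  set N := ∏ n ∈ I, b n with hN
  have hb0 : ∀ n, b n ≠ 0 := fun n => by have := hB _ (hb n).1; omega
  have hN0 : 0 < N := Finset.prod_pos fun n _ => Nat.pos_of_ne_zero (hb0 n)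
  have hKN : K.Coprime N :=
    Nat.Coprime.prod_right fun n _ => (hb n).2.coprime_mul_right_right.symm
  obtain ⟨m₁, hm₁⟩ := Nat.chineseRemainderOfFinset (fun n => n * (b n - 1)) b I
    (fun n _ => hb0 n) (fun i _ j _ hij => hbb hij)
  obtain ⟨m₀, hmK, hmN⟩ := Nat.chineseRemainder hKN (m % K).toNat m₁
  have hmI : ∀ n ∈ I, b n ∣ m₀ + n := by
    intro n hn
    have h1 : m₀ ≡ n * (b n - 1) [MOD b n] :=
      (hmN.of_dvd (Finset.dvd_prod_of_mem b hn)).trans (hm₁ n hn)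
    refine ((h1.add_right n).dvd_iff dvd_rfl).2 ⟨n, ?_⟩
    obtain ⟨k, hk⟩ := Nat.exists_eq_succ_of_ne_zero (hb0 n)
    rw [hk, Nat.succ_eq_add_one, Nat.add_sub_cancel]
    ring
  have hmA : ∀ a ∈ A, (m₀ + a).gcd (K * N) = (m + a).natAbs := by
    intro a ha
    have h1 : (m₀ + a).Coprime N := by
      refine Nat.Coprime.prod_right fun n hn => ?_
      obtain ⟨hnL, hnA⟩ := Finset.mem_sdiff.1 hn
      have hna : n ≠ a := fun h => hnA (h ▸ ha)
      have haL := (hA a ha).1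
      have hnL' := Finset.mem_range.1 hnL
      refine Nat.eq_one_of_dvd_coprimes (hb n).2.coprime_mul_left_right
        (Nat.gcd_dvd_right _ _) ?_
      have h2 := Nat.gcd_dvd_left (m₀ + a) (b n)
      have h3 := (Nat.gcd_dvd_right (m₀ + a) (b n)).trans (hmI n hn)
      rcases lt_or_gt_of_ne hna with h | h
      · have h4 := Nat.dvd_sub h2 h3
        exact h4.trans (Nat.dvd_factorial (by omega) (by omega))
      · have h4 := Nat.dvd_sub h3 h2
        exact h4.trans (Nat.dvd_factorial (by omega) (by omega))
    rw [h1.symm.gcd_mul_right_cancel_right]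
    have h2 : (m₀ : ℤ) ≡ m [ZMOD K] := by
      have h3 := (Int.natCast_modEq_iff).2 hmK
      rw [Int.toNat_of_nonneg (Int.emod_nonneg _ (by exact_mod_cast hK0.ne'))] at h3
      exact h3.trans (Int.mod_modEq _ _)
    have h4 : Int.gcd (m₀ + a) K = Int.gcd (m + a) K := by
      rw [← Int.gcd_emod, h2.add_right (a : ℤ), Int.gcd_emod]
    have h5 : (m₀ + a).gcd K = (m + a).natAbs.gcd K := by
      rwa [← Nat.cast_add, Int.gcd_natCast_natCast] at h4
    rw [h5]
    exact Nat.gcd_eq_left ((Dvd.intro _ rfl).trans (hXK a ha))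
  obtain ⟨t, -, ht, htA⟩ := exists_modEq_translate_notMem (B := B)
    (fun c hc => by have := hB c hc; omega) A m₀ (Q := K * N) (Nat.mul_pos hK0 hN0) (by
      calc ∑ a ∈ A, multDensity (coprimeQuotient B ((m₀ + a).gcd (K * N))
              (K * N / (m₀ + a).gcd (K * N)))
          ≤ ∑ _a ∈ A, (1 / (A.card + 1) : ℝ) := by
            refine Finset.sum_le_sum fun a ha => ?_
            rw [hmA a ha]
            exact (multDensity_mono (coprimeQuotient_anti B _
              (Nat.dvd_div_of_mul_dvd ((hXK a ha).mul_right N)))).trans (hT a ha).le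
        _ < 1 := by
            rw [Finset.sum_const, nsmul_eq_mul, mul_one_div, div_lt_one (by positivity)]
            linarith) 0
  refine ⟨t, fun n hn => ⟨fun h hnA => htA n hnA h, fun hnA => ?_⟩⟩
  have hnI : n ∈ I := Finset.mem_sdiff.2 ⟨Finset.mem_range.2 hn, hnA⟩
  have h1 : b n ∣ K * N := (Finset.dvd_prod_of_mem b hnI).mul_left K
  exact ⟨b n, (hb n).1, (((ht.of_dvd h1).add_right n).dvd_iff dvd_rfl).2 (hmI n hnI)⟩

theorem eta_eq_true_iff {B : Set ℕ} {n : ℤ} : eta B n = true ↔ n ∈ BFreeSet B := by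
  simp [eta]

theorem mem_Xeta {B : Set ℕ} {x : ℤ → Bool} :
    x ∈ Xeta B ↔ ∀ L : ℕ, ∃ t : ℤ, ∀ n : ℤ, n.natAbs ≤ L → x n = eta B (n + t) := by
  constructor
  · intro hx L
    have hopen : IsOpen ((Icc (-(L : ℤ)) L).pi fun n => ({x n} : Set Bool)) :=
      isOpen_set_pi (finite_Icc _ _) fun _ _ => isOpen_discrete _
    obtain ⟨_, hy, t, rfl⟩ := mem_closure_iff.1 hx _ hopen fun n _ => rfl
    exact ⟨t, fun n hn => (hy n ⟨by omega, by omega⟩).symm⟩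
  · intro h
    choose t ht using h
    refine mem_closure_of_tendsto (f := fun L : ℕ => shiftPow (t L) (eta B)) (b := atTop) ?_
      (Eventually.of_forall fun L => ⟨t L, rfl⟩)
    refine tendsto_pi_nhds.2 fun n => tendsto_const_nhds.congr' ?_
    filter_upwards [eventually_ge_atTop n.natAbs] with L hL
    exact ht L n (by omega)

theorem shiftPow_mem_Xeta {B : Set ℕ} {x : ℤ → Bool} (hx : x ∈ Xeta B) (t : ℤ) :
    shiftPow t x ∈ Xeta B := by
  rw [mem_Xeta] at hx ⊢
  intro L
  obtain ⟨s, hs⟩ := hx (L + t.natAbs)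
  refine ⟨t + s, fun n hn => ?_⟩
  rw [shiftPow, hs (n + t) (by omega), add_assoc]

theorem eta_mem_Xeta (B : Set ℕ) : eta B ∈ Xeta B :=
  subset_closure ⟨0, by funext n; simp [shiftPow]⟩

theorem Xeta_empty {x : ℤ → Bool} (hx : x ∈ Xeta ∅) : x = oneSeq := by
  funext n
  obtain ⟨t, ht⟩ := mem_Xeta.1 hx n.natAbs
  rw [ht n (by omega), oneSeq, eta_eq_true_iff]
  simp [BFreeSet]

theorem IsProximalSubshift.exists_coprime {B : Set ℕ} (hprox : IsProximalSubshift (Xeta B))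
    (hB : ∀ b ∈ B, 2 ≤ b) (hne : B.Nonempty) {T : ℕ} (hT : 0 < T) : ∃ b ∈ B, b.Coprime T := by
  by_contra! hcon
  obtain ⟨b, hb⟩ := hne
  have hb0 := hB b hb
  obtain ⟨r, -, hr⟩ :=
    hprox _ (eta_mem_Xeta B) _ (shiftPow_mem_Xeta (eta_mem_Xeta B) 1)
  obtain ⟨k, hk⟩ := (hr (b + T)).exists
  have hconst : ∀ j : ℕ, j ≤ b + T → eta B (r k + j) = eta B (r k) := by
    intro j
    induction j with
    | zero => simp
    | succ j ih =>
      intro hj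
      rw [← ih (by omega)]
      have h := hk j (by push_cast; rw [abs_of_nonneg (by positivity)]; omega)
      simp only [shiftPow] at h
      rw [add_comm (r k) (j : ℤ), h]
      congr 1
      push_cast
      ring
  have hmod : ∀ (q : ℕ) (c : ℤ), 0 < q → q ≤ b + T →
      ∃ j : ℕ, j ≤ b + T ∧ (q : ℤ) ∣ r k + j - c := by
    intro q c hq hqb
    have hq' : (q : ℤ) ≠ 0 := by exact_mod_cast hq.ne'
    have h1 := Int.emod_nonneg (c - r k) hq'
    have h2 := Int.emod_lt_of_pos (c - r k) (show (0 : ℤ) < q by exact_mod_cast hq)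
    refine ⟨((c - r k) % q).toNat, by omega, ?_⟩
    rw [Int.toNat_of_nonneg h1]
    have h3 : (q : ℤ) ∣ c - r k - (c - r k) % q := Int.dvd_self_sub_emod
    have h4 := h3.neg_right
    rwa [show -(c - r k - (c - r k) % q) = r k + (c - r k) % q - c by ring] at h4
  obtain ⟨j, hj, hbj⟩ := hmod b 0 (by omega) (by omega)
  obtain ⟨i, hi, hTi⟩ := hmod T 1 hT (by omega)
  have h1 : eta B (r k + j) ≠ true := fun h => eta_eq_true_iff.1 h b hb (by simpa using hbj)
  rw [hconst j hj, ← hconst i hi] at h1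
  refine h1 (eta_eq_true_iff.2 fun c hc hci => hcon c hc ?_)
  have h2 : ((c.gcd T : ℕ) : ℤ) ∣ r k + i :=
    (Int.natCast_dvd_natCast.2 (Nat.gcd_dvd_left c T)).trans hci
  have h3 : ((c.gcd T : ℕ) : ℤ) ∣ r k + i - 1 :=
    (Int.natCast_dvd_natCast.2 (Nat.gcd_dvd_right c T)).trans hTi
  have h4 : ((c.gcd T : ℕ) : ℤ) ∣ 1 := by simpa using dvd_sub h2 h3
  exact Nat.dvd_one.1 (by exact_mod_cast h4)

theorem IsTaut.exists_centered_window {B : Set ℕ} (hB : ∀ b ∈ B, 2 ≤ b) (htaut : IsTaut B)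
    (hcop : ∀ T > 0, ∃ b ∈ B, b.Coprime T) {m : ℤ} {L : ℕ} {S : Set ℤ}
    (hS : ∀ n ∈ S, n.natAbs ≤ L → n + m ∈ BFreeSet B) :
    ∃ t : ℤ, ∀ n : ℤ, n.natAbs ≤ L → (n + t ∈ BFreeSet B ↔ n ∈ S) := by
  classical
  obtain ⟨t, ht⟩ := htaut.exists_window hB hcop (m := m - L) (L := 2 * L + 1)
    (A := {a ∈ Finset.range (2 * L + 1) | (a : ℤ) - L ∈ S}) (by
      intro a ha
      obtain ⟨h1, h2⟩ := Finset.mem_filter.1 ha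
      rw [Finset.mem_range] at h1
      refine ⟨h1, ?_⟩
      have h3 := hS _ h2 (by omega)
      convert h3 using 1
      ring)
  refine ⟨t + L, fun n hn => ?_⟩
  obtain ⟨k, hk⟩ := Int.eq_ofNat_of_zero_le (show 0 ≤ n + L by omega)
  have h1 := ht k (by omega)
  have h2 : n + (t + L) = ((t + k : ℕ) : ℤ) := by push_cast; omega
  have h3 : (k : ℤ) - L = n := by omega
  rw [h2, natCast_mem_BFreeSet, h1, not_not, Finset.mem_filter, Finset.mem_range, h3]
  exact and_iff_right (by omega)

theorem IsTaut.mem_Xeta_of_forall {B : Set ℕ} (hB : ∀ b ∈ B, 2 ≤ b) (htaut : IsTaut B)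
    (hcop : ∀ T > 0, ∃ b ∈ B, b.Coprime T) {x : ℤ → Bool}
    (hx : ∀ L : ℕ, ∃ m : ℤ, ∀ n ∈ supp x, n.natAbs ≤ L → n + m ∈ BFreeSet B) : x ∈ Xeta B := by
  refine mem_Xeta.2 fun L => ?_
  obtain ⟨m, hm⟩ := hx L
  obtain ⟨t, ht⟩ := htaut.exists_centered_window hB hcop hm
  refine ⟨t, fun n hn => ?_⟩
  rw [Bool.eq_iff_iff, eta_eq_true_iff, ht n hn]
  rfl

theorem exists_translate_of_mem_Xeta {B : Set ℕ} {x : ℤ → Bool} (hx : x ∈ Xeta B) (L : ℕ) :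
    ∃ m : ℤ, ∀ n ∈ supp x, n.natAbs ≤ L → n + m ∈ BFreeSet B := by
  obtain ⟨m, hm⟩ := mem_Xeta.1 hx L
  exact ⟨m, fun n hn hnL => eta_eq_true_iff.1 ((hm n hnL).symm.trans hn)⟩

theorem IsTaut.hereditary_Xeta {B : Set ℕ} (hB : ∀ b ∈ B, 2 ≤ b) (htaut : IsTaut B)
    (hcop : ∀ T > 0, ∃ b ∈ B, b.Coprime T) {x y : ℤ → Bool} (hx : x ∈ Xeta B)
    (hy : supp y ⊆ supp x) : y ∈ Xeta B :=
  htaut.mem_Xeta_of_forall hB hcop fun L =>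
    (exists_translate_of_mem_Xeta hx L).imp fun _ h n hn => h n (hy hn)

theorem IsCA.map_shiftPow {B : Set ℕ} {τ : (ℤ → Bool) → (ℤ → Bool)} (hτ : IsCA (Xeta B) τ)
    {x : ℤ → Bool} (hx : x ∈ Xeta B) (t : ℤ) : τ (shiftPow t x) = shiftPow t (τ x) := by
  have hadd : ∀ (s t : ℤ) (y : ℤ → Bool), shiftPow s (shiftPow t y) = shiftPow (s + t) y := by
    intro s t y
    funext n
    simp [shiftPow, add_assoc]
  have h0 : ∀ y : ℤ → Bool, shiftPow 0 y = y := fun y => by funext n; simp [shiftPow]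
  have hnat : ∀ (k : ℕ) (y : ℤ → Bool), y ∈ Xeta B →
      τ (shiftPow k y) = shiftPow k (τ y) := by
    intro k y hy
    induction k with
    | zero => rw [Nat.cast_zero, h0, h0]
    | succ k ih =>
      have h := hτ.2.2 _ (shiftPow_mem_Xeta hy k)
      rw [ih] at h
      simp only [shift, hadd] at h
      rw [Nat.cast_succ, add_comm (k : ℤ) 1, h]
  obtain ⟨k, rfl | rfl⟩ := t.eq_nat_or_neg
  · exact hnat k x hx
  · have h := hnat k _ (shiftPow_mem_Xeta hx (-k))
    rw [hadd, add_neg_cancel] at h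
    rw [h0] at h
    rw [h, hadd, neg_add_cancel, h0]

theorem IsCA.exists_hasRadius {B : Set ℕ} {τ : (ℤ → Bool) → (ℤ → Bool)}
    (hτ : IsCA (Xeta B) τ) : ∃ ℓ : ℕ, HasRadius (Xeta B) τ ℓ := by
  have key : ∃ ℓ : ℕ, ∀ x ∈ Xeta B, ∀ y ∈ Xeta B, (∀ i : ℤ, i.natAbs ≤ ℓ → x i = y i) →
      τ x 0 = τ y 0 := by
    by_contra! hcon
    choose x hx y hy hxy hne using hcon
    have hcomp : IsCompact (Xeta B) := isClosed_closure.isCompact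
    obtain ⟨z, hz, φ, hφ, hxz⟩ := hcomp.tendsto_subseq hx
    have hyz : Tendsto (y ∘ φ) atTop (nhds z) := by
      refine tendsto_pi_nhds.2 fun i => (tendsto_pi_nhds.1 hxz i).congr' ?_
      filter_upwards [hφ.tendsto_atTop.eventually_ge_atTop i.natAbs] with k hk
      exact hxy (φ k) i (by omega)
    have hlim : ∀ w : ℕ → ℤ → Bool, (∀ k, w k ∈ Xeta B) → Tendsto w atTop (nhds z) →
        ∀ᶠ k in atTop, τ (w k) 0 = τ z 0 := by
      intro w hw hwz
      have h1 : Tendsto (fun k => τ (w k)) atTop (nhds (τ z)) :=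
        (hτ.2.1 z hz).tendsto.comp (tendsto_nhdsWithin_iff.2 ⟨hwz, Eventually.of_forall hw⟩)
      have h2 := tendsto_pi_nhds.1 h1 0
      rw [nhds_discrete, tendsto_pure] at h2
      exact h2
    obtain ⟨k, h1, h2⟩ := ((hlim _ (fun k => hx (φ k)) hxz).and
      (hlim _ (fun k => hy (φ k)) hyz)).exists
    exact hne (φ k) (h1.trans h2.symm)
  obtain ⟨ℓ, hℓ⟩ := key
  refine ⟨ℓ, fun x hx y hy n h => ?_⟩
  have h1 := hℓ _ (shiftPow_mem_Xeta hx n) _ (shiftPow_mem_Xeta hy n) fun i hi =>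
    h (i + n) (by omega) (by omega)
  rw [hτ.map_shiftPow hx, hτ.map_shiftPow hy] at h1
  simpa [shiftPow] using h1

theorem IsTaut.exists_sparse_seq {B : Set ℕ} (hB : ∀ b ∈ B, 2 ≤ b) (hprim : Primitive B)
    (htaut : IsTaut B) {b : ℕ} (hb : b ∈ B) (R : ℕ) :
    ∃ p : ℕ → ℕ, (∀ r, R ≤ p r) ∧ (∀ r r', r < r' → p r + R ≤ p r') ∧
      ∀ r, ¬ b ∣ r → p r ≡ r [MOD b] ∧ p r ∉ natMultiples B := by
  have key : ∀ r S : ℕ, ∃ n ≥ S, ¬ b ∣ r → n ≡ r [MOD b] ∧ n ∉ natMultiples B := by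
    intro r S
    by_cases hr : b ∣ r
    · exact ⟨S, le_rfl, fun h => absurd hr h⟩
    · obtain ⟨n, h1, h2, h3⟩ := htaut.exists_notMem_natMultiples_modEq hB hprim hb hr S
      exact ⟨n, h1, fun _ => ⟨h2, h3⟩⟩
  choose g hg1 hg2 using key
  let p : ℕ → ℕ := fun r => Nat.rec (g 0 R) (fun r q => g (r + 1) (q + R)) r
  have hstep : ∀ r, p r + R ≤ p (r + 1) := fun r => hg1 _ _
  have hmono : Monotone p := monotone_nat_of_le_succ fun r => by have := hstep r; omega
  refine ⟨p, fun r => (hg1 0 R).trans (hmono (Nat.zero_le r)), fun r r' h =>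
    (hstep r).trans (hmono h), fun r => ?_⟩
  cases r with
  | zero => exact hg2 0 _
  | succ r => exact hg2 (r + 1) _

theorem dvd_of_forall_not_dvd_add {b : ℕ} (hb : 0 < b) {p : ℕ → ℕ}
    (hp : ∀ r, ¬ b ∣ r → p r ≡ r [MOD b]) {z : ℤ}
    (h : ∀ r < b, ¬ b ∣ r → ¬ (b : ℤ) ∣ p r + z) : (b : ℤ) ∣ z := by
  by_contra hz
  have hb' : (b : ℤ) ≠ 0 := by exact_mod_cast hb.ne'
  obtain ⟨r, hr⟩ := Int.eq_ofNat_of_zero_le (Int.emod_nonneg (-z) hb')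
  have hrb := Int.emod_lt_of_pos (-z) (show (0 : ℤ) < b by exact_mod_cast hb)
  have h1 : (b : ℤ) ∣ -z - -z % b := Int.dvd_self_sub_emod
  rw [hr] at h1
  have h2 : ¬ b ∣ r := fun hbr => hz (by
    have := dvd_add h1 (Int.natCast_dvd_natCast.2 hbr)
    simpa using this)
  refine h r (by omega) h2 ?_
  have h3 := (Int.natCast_modEq_iff.2 (hp r h2)).dvd
  have h4 := dvd_add h1 h3
  rw [← dvd_neg]
  convert h4 using 1
  ring

open Classical in
/-- The `0-1`-sequence with support `S`. -/
noncomputable def indSeq (S : Set ℤ) : ℤ → Bool := fun n => decide (n ∈ S)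

theorem indSeq_eq_true {S : Set ℤ} {n : ℤ} : indSeq S n = true ↔ n ∈ S := by simp [indSeq]

theorem supp_indSeq (S : Set ℤ) : supp (indSeq S) = S := by
  ext n
  exact indSeq_eq_true

theorem uSeq_eq_true {n : ℤ} : uSeq n = true ↔ n = 0 := by simp [uSeq]

theorem indSeq_injective : Function.Injective indSeq := fun S S' h => by
  rw [← supp_indSeq S, h, supp_indSeq]

theorem HasRadius.mono {X : Set (ℤ → Bool)} {τ : (ℤ → Bool) → (ℤ → Bool)} {k ℓ : ℕ}
    (h : HasRadius X τ k) (hkℓ : k ≤ ℓ) : HasRadius X τ ℓ :=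
  fun x hx y hy n hxy => h x hx y hy n fun i h1 h2 => hxy i (by omega) (by omega)

theorem IsTaut.uSeq_mem_Xeta {B : Set ℕ} (hB : ∀ b ∈ B, 2 ≤ b) (htaut : IsTaut B)
    (hcop : ∀ T > 0, ∃ b ∈ B, b.Coprime T) : uSeq ∈ Xeta B := by
  refine htaut.mem_Xeta_of_forall hB hcop fun L => ⟨1, fun n hn _ b hb hbn => ?_⟩
  rw [uSeq_eq_true.1 hn, zero_add] at hbn
  have h1 : b ∣ 1 := by exact_mod_cast hbn
  have h2 := Nat.dvd_one.1 h1
  have := hB b hb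
  omega

/-- The heart of the matter: the image of a finitely supported point `1_A` is supported on every
translate `A + f` with `f` in the support of the image of `u`. -/
theorem IsTaut.sub_mem_of_map_indSeq {B : Set ℕ} (hB : ∀ b ∈ B, 2 ≤ b) (hprim : Primitive B)
    (htaut : IsTaut B) (hcop : ∀ T > 0, ∃ b ∈ B, b.Coprime T)
    {τ : (ℤ → Bool) → (ℤ → Bool)} (hτ : IsCA (Xeta B) τ) {ℓ : ℕ} (hℓ : HasRadius (Xeta B) τ ℓ)
    {A : Finset ℤ} (hA : indSeq A ∈ Xeta B) {f n : ℤ} (hf : τ uSeq f = true)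
    (hn : τ (indSeq A) n = true) : n - f ∈ A := by
  by_contra hnA
  have hM : ∀ a ∈ A, a.natAbs ≤ A.sup Int.natAbs := fun a ha => Finset.le_sup ha
  set M := A.sup Int.natAbs
  have hu := htaut.uSeq_mem_Xeta hB hcop
  obtain ⟨m, hm⟩ := exists_translate_of_mem_Xeta hA (M + n.natAbs + f.natAbs)
  rw [supp_indSeq] at hm
  obtain ⟨t, ht⟩ := htaut.exists_centered_window hB hcop hm
  have hbad : n - f + t ∉ BFreeSet B := fun h =>
    hnA ((ht (n - f) (by omega)).1 h)
  obtain ⟨b, hb, hbn⟩ : ∃ b ∈ B, (b : ℤ) ∣ n - f + t := by simpa [BFreeSet] using hbad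
  have hb0 := hB b hb
  obtain ⟨p, hpR, hpp, hpF⟩ := htaut.exists_sparse_seq hB hprim hb
    (M + n.natAbs + t.natAbs + f.natAbs + ℓ + 1)
  set S : Set ℤ := A ∪ {z | ∃ r, ¬ b ∣ r ∧ z = p r - t} with hS
  have hx : indSeq S ∈ Xeta B := by
    refine htaut.mem_Xeta_of_forall hB hcop fun L => ⟨t, fun z hz _ => ?_⟩
    rw [supp_indSeq] at hz
    rcases hz with hz | ⟨r, hr, rfl⟩
    · have := hM z hz
      exact (ht z (by omega)).2 hz
    · rw [sub_add_cancel, natCast_mem_BFreeSet]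
      exact (hpF r hr).2
  have hxn : τ (indSeq S) n = true := by
    rw [← hn]
    refine hℓ _ hx _ hA n fun i h1 h2 => ?_
    rw [Bool.eq_iff_iff, indSeq_eq_true, indSeq_eq_true]
    refine ⟨?_, Or.inl⟩
    rintro (h | ⟨r, -, h⟩)
    · exact h
    · have := hpR r
      omega
  have hxp : ∀ r, ¬ b ∣ r → τ (indSeq S) (p r - t + f) = true := by
    intro r hr
    have h1 : τ (shiftPow (-(p r - t)) uSeq) (p r - t + f) = true := by
      rw [hτ.map_shiftPow hu, shiftPow, ← hf]
      congr 1
      ring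
    rw [← h1]
    refine hℓ _ hx _ (shiftPow_mem_Xeta hu _) _ fun i h2 h3 => ?_
    rw [Bool.eq_iff_iff, indSeq_eq_true, shiftPow, uSeq_eq_true]
    refine ⟨?_, fun h => Or.inr ⟨r, hr, by omega⟩⟩
    have h4 := hpR r
    rintro (h | ⟨r', -, h⟩)
    · have := hM i h
      omega
    · rcases lt_trichotomy r r' with h5 | rfl | h5
      · have := hpp _ _ h5
        omega
      · omega
      · have := hpp _ _ h5
        omega
  obtain ⟨t', ht'⟩ := exists_translate_of_mem_Xeta (hτ.1 hx)
    (p b + t.natAbs + f.natAbs + n.natAbs)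
  have h1 : (b : ℤ) ∣ f - t + t' := by
    refine dvd_of_forall_not_dvd_add (by omega) (fun r hr => (hpF r hr).1) fun r hrb hr => ?_
    have h2 := hpp r b hrb
    have h3 := ht' _ (hxp r hr) (by omega) b hb
    rwa [show (p r : ℤ) - t + f + t' = p r + (f - t + t') by ring] at h3
  refine ht' n hxn (by omega) b hb ?_
  have h2 := dvd_add hbn h1
  rwa [show n - f + t + (f - t + t') = n + t' by ring] at h2

theorem map_indSeq_eq {B : Set ℕ} (hered : ∀ x ∈ Xeta B, ∀ y, supp y ⊆ supp x → y ∈ Xeta B)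
    {τ : (ℤ → Bool) → (ℤ → Bool)} (hinj : InjOn τ (Xeta B)) {f : ℤ}
    (hsub : ∀ A : Finset ℤ, indSeq A ∈ Xeta B → ∀ n, τ (indSeq A) n = true → n - f ∈ A)
    (A : Finset ℤ) (hA : indSeq A ∈ Xeta B) (n : ℤ) :
    τ (indSeq A) n = indSeq A (n - f) := by
  classical
  induction A using Finset.strongInduction generalizing n with
  | H A ih =>
    set A' : Finset ℤ := {a ∈ A | τ (indSeq A) (a + f) = true} with hA'
    have hAA' : A' ⊆ A := Finset.filter_subset _ _
    have h1 : τ (indSeq A) = shiftPow (-f) (indSeq A') := by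
      funext n
      rw [Bool.eq_iff_iff, shiftPow, indSeq_eq_true]
      simp only [hA', Finset.coe_filter, mem_ofPred_eq, neg_add_cancel_right]
      refine ⟨fun h => ⟨?_, h⟩, fun h => h.2⟩
      exact hsub A hA n h
    rcases hAA'.eq_or_ssubset with h | h
    · rw [h1, h]
      rfl
    · have h2 : indSeq A' ∈ Xeta B := hered _ hA _ (by
        rw [supp_indSeq, supp_indSeq]
        exact_mod_cast hAA')
      have h3 : τ (indSeq A') = τ (indSeq A) := by
        rw [h1]
        funext k
        exact ih A' h h2 k
      have h4 := indSeq_injective (hinj h2 hA h3)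
      exact absurd (Finset.coe_injective h4) h.ne

theorem IsCA.exists_map_uSeq {B : Set ℕ} {τ : (ℤ → Bool) → (ℤ → Bool)} (hτ : IsCA (Xeta B) τ)
    (hinj : InjOn τ (Xeta B)) (hu : uSeq ∈ Xeta B) : ∃ f, τ uSeq f = true := by
  by_contra! hcon
  have h1 : τ (shiftPow 1 uSeq) = τ uSeq := by
    rw [hτ.map_shiftPow hu]
    funext n
    rw [shiftPow, Bool.eq_false_of_not_eq_true (hcon n),
      Bool.eq_false_of_not_eq_true (hcon (n + 1))]
  have h2 := congrFun (hinj (shiftPow_mem_Xeta hu 1) hu h1) 0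
  simp [shiftPow, uSeq] at h2

/-- if `B` is taut and the `B`-free subshift is proximal, its automorphism
group is trivial: every bijective CA equals a power of the shift. -/
theorem aut_trivial_of_taut_proximal (B : Set ℕ)
    (hBpos : ∀ b ∈ B, 2 ≤ b) (hBprim : Primitive B)
    (htaut : IsTaut B) (hprox : IsProximalSubshift (Xeta B))
    (τ : (ℤ → Bool) → (ℤ → Bool)) (hτ : IsCA (Xeta B) τ)
    (hbij : Set.BijOn τ (Xeta B) (Xeta B)) :
    ∃ t : ℤ, Set.EqOn τ (shiftPow t) (Xeta B) := by
  rcases B.eq_empty_or_nonempty with rfl | hne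
  · refine ⟨0, fun x hx => ?_⟩
    have h0 : shiftPow 0 x = x := by funext n; simp [shiftPow]
    rw [h0, Xeta_empty (hτ.1 hx), Xeta_empty hx]
  have hcop : ∀ T > 0, ∃ b ∈ B, b.Coprime T := fun T hT =>
    hprox.exists_coprime hBpos hne hT
  obtain ⟨f, hf⟩ := hτ.exists_map_uSeq hbij.injOn (htaut.uSeq_mem_Xeta hBpos hcop)
  obtain ⟨k, hk⟩ := hτ.exists_hasRadius
  have hℓ := hk.mono (Nat.le_add_right k f.natAbs)
  refine ⟨-f, fun x hx => funext fun n => ?_⟩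
  have hered : ∀ x ∈ Xeta B, ∀ y, supp y ⊆ supp x → y ∈ Xeta B := fun x hx y hy =>
    htaut.hereditary_Xeta hBpos hcop hx hy
  set A : Finset ℤ :=
    {i ∈ Finset.Icc (n - (k + f.natAbs : ℕ)) (n + (k + f.natAbs : ℕ)) | x i = true} with hA
  have hmem : ∀ i : ℤ, n - (k + f.natAbs : ℕ) ≤ i → i ≤ n + (k + f.natAbs : ℕ) →
      x i = indSeq A i := by
    intro i h1 h2
    rw [Bool.eq_iff_iff, indSeq_eq_true, Finset.mem_coe, hA, Finset.mem_filter, Finset.mem_Icc]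
    exact (and_iff_right ⟨h1, h2⟩).symm
  have hAX : indSeq A ∈ Xeta B := hered x hx _ (by
    rw [supp_indSeq]
    exact fun i hi => (Finset.mem_filter.1 hi).2)
  rw [hℓ x hx _ hAX n hmem, map_indSeq_eq hered hbij.injOn
    (fun A hA n hn => htaut.sub_mem_of_map_indSeq hBpos hBprim hcop hτ hk hA hf hn) A hAX n,
    ← hmem (n - f) (by omega) (by omega), shiftPow, sub_eq_add_neg]
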